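/- arXiv:2107.14748 — 2 statements merged into one kernel-verified Lean document; each statement's English description precedes it below -/
import Mathlib

section
/- Assume the Riemann hypothesis. Then for every δ > 0 there exist constants C > 0 and T₀ ≥ 16 such that for all T ≥ T₀, ∫_T^{T+δ} |ζ(1+it)| dt ≤ C · log log log T. -/
open Complex Real Filter MeasureTheory intervalIntegral

/-- **Hadamard three circles theorem**, multiplicative form on a closed annulus. -/
theorem norm_le_interp_of_mem_closedBall {f : ℂ → ℂ} {c z : ℂ} {r₁ r₂ R a b : ℝ}
    (hr₁ : 0 < r₁) (hr : r₁ < r₂) (hR : r₂ < R) (hf : DifferentiableOn ℂ f (Metric.ball c R))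
    (ha : ∀ w ∈ Metric.closedBall c r₁, ‖f w‖ ≤ a) (hb : ∀ w ∈ Metric.closedBall c r₂, ‖f w‖ ≤ b)
    (hz₁ : r₁ ≤ ‖z - c‖) (hz₂ : ‖z - c‖ ≤ r₂) :
    ‖f z‖ ≤ a ^ (1 - Real.log (‖z - c‖ / r₁) / Real.log (r₂ / r₁)) *
      b ^ (Real.log (‖z - c‖ / r₁) / Real.log (r₂ / r₁)) := by
  have hr₂ : 0 < r₂ := hr₁.trans hr
  have hz0 : 0 < ‖z - c‖ := hr₁.trans_le hz₁
  have hzc : z - c ≠ 0 := norm_pos_iff.1 hz0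
  set g : ℂ → ℂ := fun w ↦ f (c + cexp w) with hg
  have hnorm (w : ℂ) : ‖(c + cexp w) - c‖ = Real.exp w.re := by
    rw [add_sub_cancel_left, Complex.norm_exp]
  have hexp_le {w : ℂ} {r : ℝ} (h0 : 0 < r) (hw : w.re ≤ Real.log r) :
      c + cexp w ∈ Metric.closedBall c r := by
    rw [mem_closedBall_iff_norm, hnorm]
    exact (Real.le_log_iff_exp_le h0).1 hw
  have hdiff : DifferentiableOn ℂ g {w | w.re < Real.log R} := by
    refine hf.comp (by fun_prop) fun w hw ↦ ?_
    rw [mem_ball_iff_norm, hnorm]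
    exact (Real.lt_log_iff_exp_lt (hr₂.trans hR)).1 hw
  have hsub : HadamardThreeLines.verticalClosedStrip (Real.log r₁) (Real.log r₂) ⊆
      {w | w.re < Real.log R} := fun w hw ↦ lt_of_le_of_lt hw.2 (Real.log_lt_log hr₂ hR)
  have hclos : closure (HadamardThreeLines.verticalStrip (Real.log r₁) (Real.log r₂)) ⊆
      HadamardThreeLines.verticalClosedStrip (Real.log r₁) (Real.log r₂) :=
    closure_minimal (Set.preimage_mono Set.Ioo_subset_Icc_self)
      (isClosed_Icc.preimage Complex.continuous_re)
  have key := HadamardThreeLines.norm_le_interp_of_mem_verticalClosedStrip'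
    (f := g) (z := Complex.log (z - c)) (a := a) (b := b) (Real.log_lt_log hr₁ hr)
    (by
      constructor
      · rw [Complex.log_re]; exact Real.log_le_log hr₁ hz₁
      · rw [Complex.log_re]; exact Real.log_le_log hz0 hz₂)
    ((hdiff.mono (hclos.trans hsub)).diffContOnCl)
    (by
      refine ⟨b, ?_⟩
      rintro _ ⟨w, hw, rfl⟩
      exact hb _ (hexp_le hr₂ hw.2))
    (fun w hw ↦ ha _ (hexp_le hr₁ (le_of_eq hw)))
    (fun w hw ↦ hb _ (hexp_le hr₂ (le_of_eq hw)))
  have h1 : g (Complex.log (z - c)) = f z := by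
    simp only [hg, Complex.exp_log hzc, add_sub_cancel]
  rwa [h1, Complex.log_re, ← Real.log_div hz0.ne' hr₁.ne', ← Real.log_div hr₂.ne' hr₁.ne'] at key

/-- A nonvanishing holomorphic function on a disc has a holomorphic logarithm there. -/
theorem exists_log_on_ball {f : ℂ → ℂ} {c : ℂ} {R : ℝ} (hR : 0 < R)
    (hf : DifferentiableOn ℂ f (Metric.ball c R)) (h0 : ∀ z ∈ Metric.ball c R, f z ≠ 0) :
    ∃ g : ℂ → ℂ, g c = 0 ∧ (∀ z ∈ Metric.ball c R, HasDerivAt g (deriv f z / f z) z) ∧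
      ∀ z ∈ Metric.ball c R, f z = f c * cexp (g z) := by
  have hd : DifferentiableOn ℂ (fun z ↦ deriv f z / f z) (Metric.ball c R) :=
    (hf.deriv Metric.isOpen_ball).div hf h0
  obtain ⟨g, hgc, hg⟩ := hd.isExactOn_ball.with_val_at c 0
  refine ⟨g, hgc, hg, fun z hz ↦ ?_⟩
  have hc : c ∈ Metric.ball c R := Metric.mem_ball_self hR
  have hq : ∀ w ∈ Metric.ball c R, HasDerivAt (fun w ↦ f w * cexp (-g w)) 0 w := by
    intro w hw
    have h1 := ((hf.differentiableAt (Metric.isOpen_ball.mem_nhds hw)).hasDerivAt).mul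
      ((hg w hw).neg.cexp)
    have hzero : deriv f w * cexp (-g w) + f w * (cexp (-g w) * -(deriv f w / f w)) = 0 := by
      have := h0 w hw
      field_simp
      ring
    exact hzero ▸ h1
  have hconst := (convex_ball c R).is_const_of_fderivWithin_eq_zero (𝕜 := ℂ)
    (f := fun w ↦ f w * cexp (-g w))
    (fun w hw ↦ (hq w hw).differentiableAt.differentiableWithinAt)
    (fun w hw ↦ by
      have h2 := (hq w hw).hasFDerivAt.hasFDerivWithinAt (s := Metric.ball c R)
      rw [h2.fderivWithin (Metric.isOpen_ball.uniqueDiffWithinAt hw)]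
      ext; simp) hz hc
  simp only [hgc, neg_zero, Complex.exp_zero, mul_one] at hconst
  rw [← hconst, mul_assoc, ← Complex.exp_add, neg_add_cancel, Complex.exp_zero, mul_one]

/-- Bound for a logarithmic derivative in terms of the growth of the function, from the
Borel–Carathéodory theorem and Cauchy's estimate. -/
theorem norm_logDeriv_le_of_growth {f : ℂ → ℂ} {c : ℂ} {r R M : ℝ} (hr : 0 < r) (hrR : r < R)
    (hM : 0 < M) (hf : DifferentiableOn ℂ f (Metric.ball c R))
    (h0 : ∀ z ∈ Metric.ball c R, f z ≠ 0)
    (hgrowth : ∀ z ∈ Metric.ball c R, ‖f z‖ ≤ ‖f c‖ * Real.exp M) {z : ℂ}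
    (hz : z ∈ Metric.closedBall c r) :
    ‖deriv f z / f z‖ ≤ 8 * R / (R - r) ^ 2 * M := by
  have hR : 0 < R := hr.trans hrR
  obtain ⟨g, hgc, hg, hexp⟩ := exists_log_on_ball hR hf h0
  have hc0 : 0 < ‖f c‖ := norm_pos_iff.2 (h0 c (Metric.mem_ball_self hR))
  have hre : ∀ w ∈ Metric.ball c R, (g w).re ≤ M := by
    intro w hw
    have h1 := hgrowth w hw
    rw [hexp w hw, norm_mul, Complex.norm_exp] at h1
    exact Real.exp_le_exp.1 (le_of_mul_le_mul_left h1 hc0)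
  have hgd : DifferentiableOn ℂ g (Metric.ball c R) :=
    fun w hw ↦ (hg w hw).differentiableAt.differentiableWithinAt
  have hmem {w : ℂ} (hw : w ∈ Metric.ball (0 : ℂ) R) : c + w ∈ Metric.ball c R := by
    rw [mem_ball_iff_norm, add_sub_cancel_left]; exact mem_ball_zero_iff.1 hw
  have hbc {w : ℂ} (hw : ‖w - c‖ ≤ (r + R) / 2) : ‖g w‖ ≤ 2 * M * R / ((R - r) / 2) := by
    have hwR : w - c ∈ Metric.ball (0 : ℂ) R := by
      rw [mem_ball_zero_iff]; linarith
    have := Complex.borelCaratheodory_zero (f := fun w ↦ g (c + w)) hM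
      (hgd.comp (by fun_prop) fun w hw ↦ hmem hw) (fun w hw ↦ hre _ (hmem hw)) hR hwR (by simpa)
    rw [add_sub_cancel] at this
    refine this.trans ?_
    have h3 : (R - r) / 2 ≤ R - ‖w - c‖ := by linarith
    have h4 : 0 < (R - r) / 2 := by linarith
    gcongr
    linarith
  have hzr : ‖z - c‖ ≤ r := mem_closedBall_iff_norm.1 hz
  have hd : 0 < (R - r) / 2 := by linarith
  have hsub : Metric.closedBall z ((R - r) / 2) ⊆ Metric.closedBall c ((r + R) / 2) := by
    refine Metric.closedBall_subset_closedBall' ?_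
    rw [dist_eq_norm]; linarith
  have hsub' : Metric.closedBall c ((r + R) / 2) ⊆ Metric.ball c R :=
    Metric.closedBall_subset_ball (by linarith)
  have hcauchy := Complex.norm_deriv_le_of_forall_mem_sphere_norm_le (c := z) (f := g) hd
    (hgd.mono (Metric.closure_ball_subset_closedBall.trans (hsub.trans hsub'))).diffContOnCl
    (fun w hw ↦ hbc (mem_closedBall_iff_norm.1 (hsub (Metric.sphere_subset_closedBall hw))))
  rw [(hg z (Metric.closedBall_subset_ball hrR hz)).deriv] at hcauchy
  refine hcauchy.trans (le_of_eq ?_)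
  have : R - r ≠ 0 := by linarith
  field_simp
  ring

/-- Term-by-term integration of an absolutely convergent cosine series against an integrable
function. -/
theorem hasSum_integral_mul_cos_series {ι : Type*} [Countable ι] {c l : ι → ℝ}
    (hc0 : ∀ i, 0 ≤ c i) (hc : Summable c) {g : ℝ → ℂ} (hg : Integrable g) (T ξ : ℝ) :
    HasSum (fun i ↦ (c i : ℂ) *
      ((cexp (I * (l i * T : ℝ)) * ∫ t, g t * cexp (I * ((ξ + l i) * t : ℝ))) +
        (cexp (I * (-(l i * T) : ℝ)) * ∫ t, g t * cexp (I * ((ξ - l i) * t : ℝ)))) / 2)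
      (∫ t, ((∑' i, c i * Real.cos (l i * (T + t)) : ℝ) : ℂ) * g t * cexp (I * (ξ * t : ℝ))) := by
  have hint (η : ℝ) : Integrable (fun t ↦ g t * cexp (I * (η * t : ℝ))) := by
    refine hg.mul_bdd (c := 1) (by fun_prop) (Eventually.of_forall fun t ↦ ?_)
    rw [mul_comm I, Complex.norm_exp_ofReal_mul_I]
  set F : ι → ℝ → ℂ := fun i t ↦
    (c i : ℂ) * (Real.cos (l i * (T + t)) : ℂ) * (g t * cexp (I * (ξ * t : ℝ))) with hF
  have hFint (i) : Integrable (F i) := by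
    refine (hint ξ).bdd_mul (c := c i) (by fun_prop) (Eventually.of_forall fun t ↦ ?_)
    rw [norm_mul, Complex.norm_real, Complex.norm_real, Real.norm_of_nonneg (hc0 i)]
    exact mul_le_of_le_one_right (hc0 i) (Real.abs_cos_le_one _)
  have hFn (i) (t) : ‖F i t‖ ≤ c i * ‖g t‖ := by
    simp only [hF]
    rw [norm_mul, norm_mul, norm_mul, Complex.norm_real, Complex.norm_real,
      Real.norm_of_nonneg (hc0 i), mul_comm I, Complex.norm_exp_ofReal_mul_I, mul_one]
    gcongr
    exact mul_le_of_le_one_right (hc0 i) (Real.abs_cos_le_one _)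
  have hsum := hasSum_integral_of_summable_integral_norm hFint (by
    refine Summable.of_nonneg_of_le (fun i ↦ integral_nonneg fun t ↦ norm_nonneg _)
      (fun i ↦ ?_) (hc.mul_right (∫ t, ‖g t‖))
    rw [← MeasureTheory.integral_const_mul]
    exact integral_mono (hFint i).norm (hg.norm.const_mul _) (hFn i))
  have hlim : ∫ t, ((∑' i, c i * Real.cos (l i * (T + t)) : ℝ) : ℂ) * g t *
      cexp (I * (ξ * t : ℝ)) = ∫ t, ∑' i, F i t := by
    congr 1
    funext t
    simp only [hF]
    rw [tsum_mul_right, mul_assoc]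
    congr 1
    push_cast
    rfl
  rw [hlim]
  refine (congrArg (fun f ↦ HasSum f _) (funext fun i ↦ ?_)).mpr hsum
  have : F i = fun t ↦ (c i : ℂ) / 2 *
      (cexp (I * (l i * T : ℝ)) * (g t * cexp (I * ((ξ + l i) * t : ℝ))) +
      cexp (I * (-(l i * T) : ℝ)) * (g t * cexp (I * ((ξ - l i) * t : ℝ)))) := by
    funext t
    simp only [hF, Complex.ofReal_cos, Complex.cos]
    have e1 : cexp (((l i * (T + t) : ℝ) : ℂ) * I) = cexp (I * (l i * T : ℝ)) *
        cexp (I * (l i * t : ℝ)) := by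
      rw [← Complex.exp_add]; congr 1; push_cast; ring
    have e2 : cexp (-((l i * (T + t) : ℝ) : ℂ) * I) = cexp (I * (-(l i * T) : ℝ)) *
        cexp (I * (-(l i * t) : ℝ)) := by
      rw [← Complex.exp_add]; congr 1; push_cast; ring
    have e3 : cexp (I * ((ξ + l i) * t : ℝ)) = cexp (I * (ξ * t : ℝ)) *
        cexp (I * (l i * t : ℝ)) := by
      rw [← Complex.exp_add]; congr 1; push_cast; ring
    have e4 : cexp (I * ((ξ - l i) * t : ℝ)) = cexp (I * (ξ * t : ℝ)) *
        cexp (I * (-(l i * t) : ℝ)) := by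
      rw [← Complex.exp_add]; congr 1; push_cast; ring
    rw [e1, e2, e3, e4]
    ring
  rw [this, MeasureTheory.integral_const_mul, integral_add ((hint _).const_mul _) ((hint _).const_mul _),
    MeasureTheory.integral_const_mul, MeasureTheory.integral_const_mul]
  ring

theorem norm_cos_series_le {ι : Type*} {c l : ι → ℝ} (hc0 : ∀ i, 0 ≤ c i) (hc : Summable c)
    (x : ℝ) : |∑' i, c i * Real.cos (l i * x)| ≤ ∑' i, c i := by
  have h (i) : ‖c i * Real.cos (l i * x)‖ ≤ c i := by
    rw [norm_mul, Real.norm_of_nonneg (hc0 i)]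
    exact mul_le_of_le_one_right (hc0 i) (Real.abs_cos_le_one _)
  exact tsum_of_norm_bounded hc.hasSum h

theorem continuous_cos_series {ι : Type*} {c l : ι → ℝ} (hc0 : ∀ i, 0 ≤ c i) (hc : Summable c) :
    Continuous fun x : ℝ ↦ ∑' i, c i * Real.cos (l i * x) := by
  refine continuous_tsum (fun i ↦ by fun_prop) hc fun i x ↦ ?_
  rw [norm_mul, Real.norm_of_nonneg (hc0 i)]
  exact mul_le_of_le_one_right (hc0 i) (Real.abs_cos_le_one _)

theorem integrable_cos_series_pow_mul {ι : Type*} {c l : ι → ℝ} (hc0 : ∀ i, 0 ≤ c i)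
    (hc : Summable c) {w : ℝ → ℂ} (hw : Integrable w) (T : ℝ) (k : ℕ) :
    Integrable fun t ↦ ((∑' i, c i * Real.cos (l i * (T + t)) : ℝ) : ℂ) ^ k * w t := by
  have hcont := continuous_cos_series (l := l) hc0 hc
  refine hw.bdd_mul (c := (∑' i, c i) ^ k) ?_ (Eventually.of_forall fun t ↦ ?_)
  · exact ((Complex.continuous_ofReal.comp (hcont.comp (continuous_const.add
      continuous_id))).pow k).aestronglyMeasurable
  · rw [norm_pow, Complex.norm_real]
    exact pow_le_pow_left₀ (norm_nonneg _) (norm_cos_series_le hc0 hc _) _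

/-- Against a weight with nonnegative Fourier transform, translating a cosine series with
nonnegative coefficients does not increase the Fourier transform of its powers. -/
theorem norm_integral_cos_series_pow_le {ι : Type*} [Countable ι] {c l : ι → ℝ}
    (hc0 : ∀ i, 0 ≤ c i) (hc : Summable c) {w : ℝ → ℂ} (hw : Integrable w)
    (hpos : ∀ ξ : ℝ, ‖∫ t, w t * cexp (I * (ξ * t : ℝ))‖ ≤
      (∫ t, w t * cexp (I * (ξ * t : ℝ))).re) (T : ℝ) (k : ℕ) (ξ : ℝ) :
    ‖∫ t, ((∑' i, c i * Real.cos (l i * (T + t)) : ℝ) : ℂ) ^ k * w t * cexp (I * (ξ * t : ℝ))‖ ≤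
      (∫ t, ((∑' i, c i * Real.cos (l i * (0 + t)) : ℝ) : ℂ) ^ k * w t *
        cexp (I * (ξ * t : ℝ))).re := by
  induction k generalizing ξ with
  | zero => simpa using hpos ξ
  | succ k ih =>
    have h1 := hasSum_integral_mul_cos_series (l := l) hc0 hc
      (integrable_cos_series_pow_mul (l := l) hc0 hc hw T k) T ξ
    have h2 := Complex.hasSum_re (hasSum_integral_mul_cos_series (l := l) hc0 hc
      (integrable_cos_series_pow_mul (l := l) hc0 hc hw 0 k) 0 ξ)
    simp only [← mul_assoc, ← pow_succ'] at h1 h2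
    rw [← h1.tsum_eq]
    refine tsum_of_norm_bounded h2 fun i ↦ ?_
    simp only [mul_zero, neg_zero, Complex.ofReal_zero, Complex.exp_zero, one_mul]
    rw [mul_div_assoc, norm_mul, norm_div, Complex.norm_real, Real.norm_of_nonneg (hc0 i),
      mul_div_assoc, Complex.re_ofReal_mul]
    refine mul_le_mul_of_nonneg_left ?_ (hc0 i)
    rw [show (2 : ℂ) = ((2 : ℝ) : ℂ) by norm_num, Complex.div_ofReal_re, Complex.norm_real,
      Real.norm_of_nonneg (by norm_num : (0 : ℝ) ≤ 2), Complex.add_re]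
    refine div_le_div_of_nonneg_right ((norm_add_le _ _).trans (add_le_add ?_ ?_)) (by norm_num)
    · rw [norm_mul, mul_comm I, Complex.norm_exp_ofReal_mul_I, one_mul]
      exact ih _
    · rw [norm_mul, mul_comm I, Complex.norm_exp_ofReal_mul_I, one_mul]
      exact ih _

theorem hasSum_integral_exp_cos_series {ι : Type*} {c l : ι → ℝ}
    (hc0 : ∀ i, 0 ≤ c i) (hc : Summable c) {w : ℝ → ℂ} (hw : Integrable w) (T : ℝ) :
    HasSum (fun k : ℕ ↦ ((k.factorial : ℝ)⁻¹ : ℂ) *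
        ∫ t, ((∑' i, c i * Real.cos (l i * (T + t)) : ℝ) : ℂ) ^ k * w t)
      (∫ t, (Real.exp (∑' i, c i * Real.cos (l i * (T + t))) : ℂ) * w t) := by
  set F : ℕ → ℝ → ℂ := fun k t ↦ ((k.factorial : ℝ)⁻¹ : ℂ) *
    (((∑' i, c i * Real.cos (l i * (T + t)) : ℝ) : ℂ) ^ k * w t) with hF
  have hFint (k) : Integrable (F k) :=
    (integrable_cos_series_pow_mul (l := l) hc0 hc hw T k).const_mul _
  have hsum := hasSum_integral_of_summable_integral_norm hFint (by
    refine Summable.of_nonneg_of_le (fun i ↦ integral_nonneg fun t ↦ norm_nonneg _)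
      (fun k ↦ ?_) ((Real.summable_pow_div_factorial (∑' i, c i)).mul_right (∫ t, ‖w t‖))
    rw [← MeasureTheory.integral_const_mul]
    refine integral_mono (hFint k).norm (hw.norm.const_mul _) fun t ↦ ?_
    simp only [hF]
    rw [norm_mul, norm_mul, norm_pow, Complex.norm_real, div_eq_inv_mul, mul_assoc, norm_inv,
      Complex.norm_real, Real.norm_of_nonneg (by positivity : (0 : ℝ) ≤ k.factorial)]
    gcongr
    exact norm_cos_series_le hc0 hc _)
  have hlim : ∫ t, (Real.exp (∑' i, c i * Real.cos (l i * (T + t))) : ℂ) * w t =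
      ∫ t, ∑' k, F k t := by
    congr 1
    funext t
    simp only [hF, ← mul_assoc]
    rw [tsum_mul_right, Complex.ofReal_exp, Complex.exp_eq_exp_ℂ, NormedSpace.exp_eq_tsum_div]
    congr 1
    refine tsum_congr fun k ↦ ?_
    push_cast
    rw [div_eq_inv_mul]
  rw [hlim]
  refine (congrArg (fun f ↦ HasSum f _) (funext fun k ↦ ?_)).mpr hsum
  rw [MeasureTheory.integral_const_mul]

/-- Majorant principle: for a weight with nonnegative Fourier transform, the weighted mean of the
exponential of a cosine series with nonnegative coefficients is largest when it is centred at
the origin. -/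
theorem integral_exp_cos_series_translate_le {ι : Type*} [Countable ι] {c l : ι → ℝ}
    (hc0 : ∀ i, 0 ≤ c i) (hc : Summable c) {w : ℝ → ℝ} (hw : Integrable w)
    (hpos : ∀ ξ : ℝ, ‖∫ t, (w t : ℂ) * cexp (I * (ξ * t : ℝ))‖ ≤
      (∫ t, (w t : ℂ) * cexp (I * (ξ * t : ℝ))).re) (T : ℝ) :
    ∫ t, Real.exp (∑' i, c i * Real.cos (l i * (T + t))) * w t ≤
      ∫ t, Real.exp (∑' i, c i * Real.cos (l i * t)) * w t := by
  have hwC : Integrable fun t ↦ (w t : ℂ) := hw.ofReal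
  have h1 := hasSum_integral_exp_cos_series (l := l) hc0 hc hwC T
  have h2 := Complex.hasSum_re (hasSum_integral_exp_cos_series (l := l) hc0 hc hwC 0)
  have h3 : ‖∫ t, (Real.exp (∑' i, c i * Real.cos (l i * (T + t))) : ℂ) * (w t : ℂ)‖ ≤
      (∫ t, (Real.exp (∑' i, c i * Real.cos (l i * (0 + t))) : ℂ) * (w t : ℂ)).re := by
    rw [← h1.tsum_eq]
    refine tsum_of_norm_bounded h2 fun k ↦ ?_
    rw [← Complex.ofReal_inv, Complex.re_ofReal_mul, norm_mul, Complex.norm_real,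
      Real.norm_of_nonneg (by positivity)]
    refine mul_le_mul_of_nonneg_left ?_ (by positivity)
    simpa using norm_integral_cos_series_pow_le (l := l) hc0 hc hwC hpos T k 0
  simp only [← Complex.ofReal_mul, zero_add] at h3
  rw [integral_complex_ofReal, integral_complex_ofReal, Complex.norm_real, Complex.ofReal_re] at h3
  exact (le_abs_self _).trans h3

theorem norm_fract_mul_cpow_le {t : ℝ} (ht : 0 < t) (s : ℂ) :
    ‖((Int.fract t : ℝ) : ℂ) * (t : ℂ) ^ (-(s + 1))‖ ≤ t ^ (-(s.re + 1)) := by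
  rw [norm_mul, Complex.norm_real, Real.norm_of_nonneg (Int.fract_nonneg t),
    Complex.norm_cpow_eq_rpow_re_of_pos ht]
  simp only [Complex.neg_re, Complex.add_re, Complex.one_re]
  exact mul_le_of_le_one_left (Real.rpow_nonneg ht.le _) (Int.fract_lt_one t).le

theorem norm_integral_fract_mul_cpow_le {s : ℂ} (hs : 0 < s.re) :
    ‖∫ t in Set.Ioi (1 : ℝ), ((Int.fract t : ℝ) : ℂ) * (t : ℂ) ^ (-(s + 1))‖ ≤ 1 / s.re := by
  have h1 : -(s.re + 1) < -1 := by linarith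
  have h := norm_integral_le_of_norm_le (integrableOn_Ioi_rpow_of_lt h1 one_pos)
    ((ae_restrict_mem measurableSet_Ioi).mono fun t (ht : 1 < t) ↦
      norm_fract_mul_cpow_le (one_pos.trans ht) s)
  rw [integral_Ioi_rpow_of_lt h1 one_pos] at h
  refine h.trans (le_of_eq ?_)
  rw [Real.one_rpow]
  have : s.re ≠ 0 := hs.ne'
  rw [show -(s.re + 1) + 1 = -s.re by ring]
  field_simp

theorem differentiableOn_integral_fract_mul_cpow :
    DifferentiableOn ℂ (fun s : ℂ ↦ ∫ t in Set.Ioi (1 : ℝ), ((Int.fract t : ℝ) : ℂ) * (t : ℂ) ^ (-(s + 1)))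
      {s | 0 < s.re} := by
  set f : ℝ → ℂ := (Set.Ioi (1 : ℝ)).indicator fun t ↦ ((Int.fract t : ℝ) : ℂ) with hf
  have hmeas : Measurable f :=
    (Complex.measurable_ofReal.comp measurable_fract).indicator measurableSet_Ioi
  have hbd (t : ℝ) : ‖f t‖ ≤ 1 := by
    refine (norm_indicator_le_norm_self _ _).trans ?_
    rw [Complex.norm_real, Real.norm_of_nonneg (Int.fract_nonneg t)]
    exact (Int.fract_lt_one t).le
  have hloc : LocallyIntegrableOn f (Set.Ioi 0) := by
    refine LocallyIntegrable.locallyIntegrableOn ?_ _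
    exact (locallyIntegrable_const (1 : ℝ)).mono hmeas.aestronglyMeasurable
      (Eventually.of_forall fun t ↦ by simpa using hbd t)
  have heq (s : ℂ) : ∫ t in Set.Ioi (1 : ℝ), ((Int.fract t : ℝ) : ℂ) * (t : ℂ) ^ (-(s + 1)) =
      mellin f (-s) := by
    rw [mellin, ← MeasureTheory.integral_indicator measurableSet_Ioi, ← MeasureTheory.integral_indicator measurableSet_Ioi]
    congr 1
    funext t
    by_cases ht : 1 < t
    · rw [Set.indicator_of_mem (by exact ht), Set.indicator_of_mem (by exact one_pos.trans ht), hf,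
        Set.indicator_of_mem (by exact ht), smul_eq_mul, mul_comm,
        show -(s + 1) = -s - 1 by ring]
    · rw [Set.indicator_of_notMem (by exact ht), hf]
      by_cases h0 : 0 < t
      · rw [Set.indicator_of_mem (by exact h0), Set.indicator_of_notMem (by exact ht), smul_zero]
      · rw [Set.indicator_of_notMem (by exact h0)]
  intro s hs
  simp only [heq]
  refine DifferentiableAt.differentiableWithinAt ?_
  have hm : DifferentiableAt ℂ (mellin f) (-s) := by
    refine mellin_differentiableAt_of_isBigO_rpow (a := 0) (b := (-s).re - 1) hloc ?_ ?_ ?_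
      (by linarith)
    · refine Asymptotics.isBigO_of_le _ fun t ↦ ?_
      simpa using hbd t
    · simpa using hs
    · refine (Asymptotics.isBigO_zero _ _).congr' ?_ EventuallyEq.rfl
      filter_upwards [mem_nhdsWithin_of_mem_nhds (Iio_mem_nhds one_pos)] with t ht
      exact (Set.indicator_of_notMem (not_lt.2 (le_of_lt ht)) _).symm
  exact hm.comp s differentiableAt_id.neg

theorem riemannZeta_eq_sub_integral_fract_of_one_lt {s : ℂ} (hs : 1 < s.re) :
    riemannZeta s = s / (s - 1) -
      s * ∫ t in Set.Ioi (1 : ℝ), ((Int.fract t : ℝ) : ℂ) * (t : ℂ) ^ (-(s + 1)) := by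
  have h1 := LSeries_eq_mul_integral_of_nonneg (fun _ ↦ 1) zero_le_one (s := s) hs
    (by
      refine Asymptotics.isBigO_of_le _ fun n ↦ ?_
      simp) (fun _ ↦ zero_le_one)
  have h2 : LSeries (fun _ ↦ ((1 : ℝ) : ℂ)) s = riemannZeta s := by
    rw [← LSeries_one_eq_riemannZeta hs]
    congr 1
  rw [← h2, h1]
  have hre : (-s).re < -1 := by simpa using hs
  have h3 : ∫ t in Set.Ioi (1 : ℝ), (t : ℂ) ^ (-s) = 1 / (s - 1) := by
    rw [integral_Ioi_cpow_of_lt hre one_pos, Complex.ofReal_one, Complex.one_cpow,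
      show -s + 1 = -(s - 1) by ring, neg_div_neg_eq]
  have hsi : IntegrableOn (fun t : ℝ ↦ (t : ℂ) ^ (-s)) (Set.Ioi 1) :=
    integrableOn_Ioi_cpow_of_lt hre one_pos
  have hfi : IntegrableOn (fun t : ℝ ↦ ((Int.fract t : ℝ) : ℂ) * (t : ℂ) ^ (-(s + 1))) (Set.Ioi 1) := by
    refine Integrable.mono' (integrableOn_Ioi_rpow_of_lt (a := -(s.re + 1)) (by linarith) one_pos)
      ?_ ((ae_restrict_mem measurableSet_Ioi).mono fun t (ht : 1 < t) ↦
        norm_fract_mul_cpow_le (one_pos.trans ht) s)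
    refine ((Complex.measurable_ofReal.comp measurable_fract).mul ?_).aestronglyMeasurable
    fun_prop
  rw [div_eq_mul_one_div, ← h3, ← mul_sub, ← integral_sub hsi hfi]
  congr 1
  refine setIntegral_congr_fun measurableSet_Ioi fun t (ht : 1 < t) ↦ ?_
  have ht0 : (t : ℂ) ≠ 0 := by exact_mod_cast (one_pos.trans ht).ne'
  have hfl : ((⌊t⌋₊ : ℕ) : ℂ) = (t : ℂ) - ((Int.fract t : ℝ) : ℂ) := by
    have : ((⌊t⌋₊ : ℕ) : ℝ) = t - Int.fract t := by
      rw [natCast_floor_eq_intCast_floor (one_pos.trans ht).le, Int.self_sub_fract]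
    rw [← Complex.ofReal_sub, ← this, Complex.ofReal_natCast]
  have hpow : (t : ℂ) ^ (-s) = t * (t : ℂ) ^ (-(s + 1)) := by
    rw [show -s = -(s + 1) + 1 by ring, Complex.cpow_add _ _ ht0, Complex.cpow_one, mul_comm]
  simp only [Complex.ofReal_one, Finset.sum_const, Nat.card_Icc, add_tsub_cancel_right,
    nsmul_eq_mul, mul_one]
  rw [hfl, hpow, sub_mul]

theorem riemannZeta_eq_sub_integral_fract_of_im_pos {s : ℂ} (hs : 0 < s.re) (him : 0 < s.im) :
    riemannZeta s = s / (s - 1) -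
      s * ∫ t in Set.Ioi (1 : ℝ), ((Int.fract t : ℝ) : ℂ) * (t : ℂ) ^ (-(s + 1)) := by
  set U : Set ℂ := {z | 0 < z.re} ∩ {z | 0 < z.im} with hU
  have hUo : IsOpen U := (isOpen_lt continuous_const Complex.continuous_re).inter
    (isOpen_lt continuous_const Complex.continuous_im)
  have hUc : Convex ℝ U := (convex_halfSpace_re_gt 0).inter (convex_halfSpace_im_gt 0)
  have hne {z : ℂ} (hz : z ∈ U) : z ≠ 1 := by
    rintro rfl
    simp [hU] at hz
  have hz₀ : (2 + I : ℂ) ∈ U := by simp [hU]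
  refine AnalyticOnNhd.eqOn_of_preconnected_of_eventuallyEq (𝕜 := ℂ) (U := U)
    (f := riemannZeta) (g := fun s ↦ s / (s - 1) -
      s * ∫ t in Set.Ioi (1 : ℝ), ((Int.fract t : ℝ) : ℂ) * (t : ℂ) ^ (-(s + 1)))
    (DifferentiableOn.analyticOnNhd (fun z hz ↦
      (differentiableAt_riemannZeta (hne hz)).differentiableWithinAt) hUo)
    (DifferentiableOn.analyticOnNhd ?_ hUo) hUc.isPreconnected hz₀ ?_ ⟨hs, him⟩
  · refine DifferentiableOn.sub (differentiableOn_id.div (differentiableOn_id.sub_const 1)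
      fun z hz ↦ sub_ne_zero.2 (hne hz)) (differentiableOn_id.mul
      (differentiableOn_integral_fract_mul_cpow.mono Set.inter_subset_left))
  · filter_upwards [(isOpen_lt continuous_const Complex.continuous_re).mem_nhds
      (show (1 : ℝ) < (2 + I : ℂ).re by simp)] with z hz
    exact riemannZeta_eq_sub_integral_fract_of_one_lt hz

theorem norm_riemannZeta_le {s : ℂ} (hs : 1 < s.re ∨ (0 < s.re ∧ 0 < s.im)) :
    ‖riemannZeta s‖ ≤ ‖s‖ * (1 / ‖s - 1‖ + 1 / s.re) := by
  have hre : 0 < s.re := hs.elim one_pos.trans fun h ↦ h.1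
  have h : riemannZeta s = s / (s - 1) -
      s * ∫ t in Set.Ioi (1 : ℝ), ((Int.fract t : ℝ) : ℂ) * (t : ℂ) ^ (-(s + 1)) :=
    hs.elim riemannZeta_eq_sub_integral_fract_of_one_lt fun h ↦
      riemannZeta_eq_sub_integral_fract_of_im_pos h.1 h.2
  rw [h, mul_add, mul_one_div, ← norm_div]
  refine (norm_sub_le _ _).trans (add_le_add le_rfl ?_)
  rw [norm_mul]
  exact mul_le_mul_of_nonneg_left (norm_integral_fract_mul_cpow_le hre) (norm_nonneg _)

/-- The logarithmic derivative of `ζ` to the right of the line `re s = 1`. -/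
theorem exists_norm_logDeriv_riemannZeta_le :
    ∃ K > (0 : ℝ), ∀ η : ℝ, 0 < η → η ≤ 1 → ∀ s : ℂ, 1 + η ≤ s.re →
      ‖deriv riemannZeta s / riemannZeta s‖ ≤ K / η := by
  have hres : (fun n ↦ ((ArithmeticFunction.vonMangoldt.residueClass (0 : ZMod 1) n : ℝ) : ℂ)) =
      fun n ↦ ((ArithmeticFunction.vonMangoldt n : ℝ) : ℂ) := by
    funext n
    simp [ArithmeticFunction.vonMangoldt.residueClass, Subsingleton.elim ((n : ZMod 1)) 0]
  have hcont := (ArithmeticFunction.vonMangoldt.continuousOn_LFunctionResidueClassAux (0 : ZMod 1))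
  have heq := ArithmeticFunction.vonMangoldt.eqOn_LFunctionResidueClassAux (a := (0 : ZMod 1))
    (by rw [Subsingleton.elim (0 : ZMod 1) 1]; exact isUnit_one)
  have hcont' : ContinuousOn (fun x : ℝ ↦
      ArithmeticFunction.vonMangoldt.LFunctionResidueClassAux (0 : ZMod 1) (x : ℂ))
      (Set.Icc 1 2) :=
    hcont.comp Complex.continuous_ofReal.continuousOn fun x hx ↦ by simpa using hx.1
  obtain ⟨B, hB⟩ := isCompact_Icc.exists_bound_of_continuousOn hcont'
  refine ⟨|B| + 1, by positivity, fun η hη hη1 s hs ↦ ?_⟩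
  have hs1 : 1 < s.re := by linarith
  have hL := ArithmeticFunction.LSeries_vonMangoldt_eq_deriv_riemannZeta_div hs1
  have hr : 1 < (((1 + η : ℝ) : ℂ)).re := by simpa using hη
  have hsum := ArithmeticFunction.LSeriesSummable_vonMangoldt hr
  have hbound : ‖LSeries (fun n ↦ ((ArithmeticFunction.vonMangoldt n : ℝ) : ℂ)) s‖ ≤
      ‖LSeries (fun n ↦ ((ArithmeticFunction.vonMangoldt n : ℝ) : ℂ)) ((1 + η : ℝ) : ℂ)‖ := by
    have hreal : LSeries (fun n ↦ ((ArithmeticFunction.vonMangoldt n : ℝ) : ℂ))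
        ((1 + η : ℝ) : ℂ) = ((∑' n, ‖LSeries.term
          (fun n ↦ ((ArithmeticFunction.vonMangoldt n : ℝ) : ℂ)) ((1 + η : ℝ) : ℂ) n‖ : ℝ) : ℂ) := by
      rw [LSeries, Complex.ofReal_tsum]
      refine tsum_congr fun n ↦ ?_
      rcases eq_or_ne n 0 with rfl | hn
      · simp
      · rw [LSeries.term_of_ne_zero hn, norm_div, Complex.norm_real,
          Real.norm_of_nonneg ArithmeticFunction.vonMangoldt_nonneg,
          ← Complex.ofReal_natCast, ← Complex.ofReal_cpow (Nat.cast_nonneg n), Complex.norm_real,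
          Real.norm_of_nonneg (by positivity), Complex.ofReal_div]
    rw [hreal, Complex.norm_real, Real.norm_of_nonneg (tsum_nonneg fun n ↦ norm_nonneg _)]
    exact tsum_of_norm_bounded hsum.norm.hasSum fun n ↦
      LSeries.norm_term_le_of_re_le_re _ (by simpa using hs) n
  have he := heq hr
  simp only [hres] at he
  have hLη : LSeries (fun n ↦ ((ArithmeticFunction.vonMangoldt n : ℝ) : ℂ)) ((1 + η : ℝ) : ℂ) =
      ArithmeticFunction.vonMangoldt.LFunctionResidueClassAux (0 : ZMod 1) ((1 + η : ℝ) : ℂ) +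
        ((1 / η : ℝ) : ℂ) := by
    rw [he]
    simp
  have hBη := hB (1 + η) ⟨by linarith, by linarith⟩
  calc ‖deriv riemannZeta s / riemannZeta s‖
      = ‖LSeries (fun n ↦ ((ArithmeticFunction.vonMangoldt n : ℝ) : ℂ)) s‖ := by
        rw [hL, neg_div, norm_neg]
    _ ≤ B + 1 / η := by
        refine hbound.trans ?_
        rw [hLη]
        refine (norm_add_le _ _).trans (add_le_add hBη ?_)
        rw [Complex.norm_real, Real.norm_of_nonneg (by positivity)]
    _ ≤ (|B| + 1) / η := by
        rw [add_div]
        gcongr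
        exact (le_abs_self B).trans (le_div_self (abs_nonneg B) hη hη1)

theorem riemannZeta_ne_zero_of_half_lt_re (hRH : RiemannHypothesis) {s : ℂ} (hs : 1 / 2 < s.re)
    (h1 : s ≠ 1) : riemannZeta s ≠ 0 := by
  intro h0
  refine hs.ne' (hRH s h0 ?_ h1)
  rintro ⟨n, rfl⟩
  have : (-2 * ((n : ℂ) + 1)).re = -2 * ((n : ℝ) + 1) := by simp
  rw [this] at hs
  have : (0 : ℝ) ≤ n := n.cast_nonneg
  linarith

theorem one_third_le_norm_riemannZeta {s : ℂ} (hs : s.re = 2) : 1 / 3 ≤ ‖riemannZeta s‖ := by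
  have hs1 : 1 < s.re := by linarith
  have hz := zeta_eq_tsum_one_div_nat_add_one_cpow hs1
  have h2 := (hasSum_nat_add_iff' 1).mpr hasSum_zeta_two
  have hnorm (n : ℕ) : ‖1 / ((n : ℂ) + 1) ^ s‖ = 1 / ((n + 1 : ℕ) : ℝ) ^ 2 := by
    rw [norm_div, norm_one, ← Nat.cast_add_one, Complex.norm_natCast_cpow_of_pos n.succ_pos, hs,
      Real.rpow_two]
  have hsum : Summable fun n : ℕ ↦ 1 / ((n : ℂ) + 1) ^ s := by
    refine Summable.of_norm ?_
    simp only [hnorm]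
    exact (summable_nat_add_iff 1).mpr hasSum_zeta_two.summable
  have h3 := (hasSum_nat_add_iff' 1).mpr h2
  have hle : ‖∑' n : ℕ, 1 / (((n + 1 : ℕ) : ℂ) + 1) ^ s‖ ≤ _ :=
    tsum_of_norm_bounded h3 fun n ↦ (hnorm (n + 1)).le
  rw [hsum.tsum_eq_zero_add] at hz
  simp only [Nat.cast_zero, zero_add, Complex.one_cpow, div_one] at hz
  have hpi : π ^ 2 < 3.15 ^ 2 := by
    have := Real.pi_lt_d2
    have := Real.pi_pos
    gcongr
  have hB : ‖riemannZeta s - 1‖ ≤ 2 / 3 := by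
    rw [hz, add_sub_cancel_left]
    refine hle.trans ?_
    norm_num at hpi ⊢
    linarith
  have := norm_sub_norm_le (1 : ℂ) (1 - riemannZeta s)
  rw [sub_sub_cancel, norm_one, norm_sub_rev] at this
  linarith

theorem norm_riemannZeta_le_of_mem_ball {τ : ℝ} (hτ : 18 ≤ τ) {z : ℂ}
    (hz : z ∈ Metric.ball ((2 : ℂ) + τ * I) (11 / 8)) :
    5 / 8 < z.re ∧ 1 < z.im ∧ ‖riemannZeta z‖ ≤ 6 * τ := by
  rw [mem_ball_iff_norm] at hz
  have hre := (Complex.abs_re_le_norm _).trans_lt hz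
  have him := (Complex.abs_im_le_norm _).trans_lt hz
  rw [abs_lt] at hre him
  simp at hre him
  have h1 : 5 / 8 < z.re := by linarith
  have h2 : 1 < z.im := by linarith
  refine ⟨h1, h2, ?_⟩
  have hn : ‖z‖ ≤ 2 * τ := by
    have h3 := norm_le_norm_sub_add z ((2 : ℂ) + τ * I)
    have h4 : ‖(2 : ℂ) + τ * I‖ ≤ 2 + τ := by
      refine (norm_add_le _ _).trans ?_
      rw [norm_mul, Complex.norm_I, mul_one, Complex.norm_real, Real.norm_of_nonneg (by linarith)]
      simp
    linarith
  have hn1 : 1 ≤ ‖z - 1‖ := by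
    have := (le_abs_self _).trans (Complex.abs_im_le_norm (z - 1))
    simp at this
    linarith
  have h5 : 1 / ‖z - 1‖ ≤ 1 := by
    rw [div_le_one (by linarith)]; exact hn1
  have h6 : 1 / z.re ≤ 2 := by
    rw [div_le_iff₀ (by linarith)]; linarith
  calc ‖riemannZeta z‖ ≤ ‖z‖ * (1 / ‖z - 1‖ + 1 / z.re) :=
        norm_riemannZeta_le (Or.inr ⟨by linarith, by linarith⟩)
    _ ≤ (2 * τ) * (1 + 2) := by gcongr
    _ = 6 * τ := by ring

/-- Under the Riemann hypothesis, `ζ` on the line `re s = 1` is controlled by its values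
slightly to the right of that line. -/
theorem exists_norm_riemannZeta_one_add_le (hRH : RiemannHypothesis) :
    ∃ K > (0 : ℝ), ∀ L η τ : ℝ, 2816 ≤ L → η = 1 / Real.log L → η ≤ 1 / 2 → 18 ≤ τ →
      Real.log τ ≤ 2 * L →
      ‖riemannZeta (1 + τ * I)‖ ≤ K * ‖riemannZeta (((1 + η : ℝ) : ℂ) + τ * I)‖ := by
  obtain ⟨K₀, hK₀, hlog⟩ := exists_norm_logDeriv_riemannZeta_le
  refine ⟨Real.exp ((K₀ + 1) * Real.exp 20), Real.exp_pos _, fun L η τ hL hηL hη hτ hτL ↦ ?_⟩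
  have hlogL : 0 < Real.log L := Real.log_pos (by linarith)
  have hη0 : 0 < η := by rw [hηL]; positivity
  set c : ℂ := (2 : ℂ) + τ * I with hc
  have hcre : c.re = 2 := by simp [hc]
  have hb := @norm_riemannZeta_le_of_mem_ball τ hτ
  have hne {z : ℂ} (hz : z ∈ Metric.ball c (11 / 8)) : z ≠ 1 := by
    rintro rfl
    have := (hb hz).2.1
    norm_num at this
  have hζ0 : ∀ z ∈ Metric.ball c (11 / 8), riemannZeta z ≠ 0 := fun z hz ↦
    riemannZeta_ne_zero_of_half_lt_re hRH (by linarith [(hb hz).1]) (hne hz)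
  have hζd : DifferentiableOn ℂ riemannZeta (Metric.ball c (11 / 8)) := fun z hz ↦
    (differentiableAt_riemannZeta (hne hz)).differentiableWithinAt
  obtain ⟨g, -, hg, hexp⟩ := exists_log_on_ball (by norm_num) hζd hζ0
  have hlogτ : 0 < Real.log τ := Real.log_pos (by linarith)
  have houter : ∀ z ∈ Metric.closedBall c (5 / 4),
      ‖deriv riemannZeta z / riemannZeta z‖ ≤ L ^ 2 := by
    intro z hz
    refine (norm_logDeriv_le_of_growth (M := 2 * Real.log τ) (R := 11 / 8) (by norm_num)
      (by norm_num) (by positivity) hζd hζ0 (fun w hw ↦ ?_) hz).trans ?_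
    · refine (hb hw).2.2.trans ?_
      have h3 := one_third_le_norm_riemannZeta hcre
      rw [two_mul, Real.exp_add, Real.exp_log (by linarith)]
      nlinarith [mul_le_mul_of_nonneg_right h3 (show 0 ≤ τ * τ by positivity)]
    · norm_num
      nlinarith
  have hinner : ∀ z ∈ Metric.closedBall c (1 - η),
      ‖deriv riemannZeta z / riemannZeta z‖ ≤ (K₀ + 1) / η := by
    intro z hz
    have hre : 1 + η ≤ z.re := by
      have := (neg_le_of_abs_le (Complex.abs_re_le_norm (z - c))).trans'
        (neg_le_neg (mem_closedBall_iff_norm.1 hz))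
      rw [Complex.sub_re, hcre] at this
      linarith
    refine (hlog η hη0 (by linarith) z hre).trans ?_
    gcongr
    linarith
  have hFd : DifferentiableOn ℂ (fun z ↦ deriv riemannZeta z / riemannZeta z)
      (Metric.ball c (11 / 8)) := (hζd.deriv Metric.isOpen_ball).div hζd hζ0
  have hseg : ∀ z ∈ Set.Icc (1 : ℝ) (1 + η) ×ℂ {τ}, z ∈ Metric.ball c (11 / 8) ∧
      ‖deriv riemannZeta z / riemannZeta z‖ ≤ (K₀ + 1) * Real.exp 20 / η := by
    intro z hz
    obtain ⟨⟨hz1, hz2⟩, hz3⟩ := Complex.mem_reProdIm.1 hz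
    have hzc : ‖z - c‖ = 2 - z.re := by
      have : z - c = ((z.re - 2 : ℝ) : ℂ) := by
        apply Complex.ext <;> simp [hc, Set.mem_singleton_iff.1 hz3]
      rw [this, Complex.norm_real, Real.norm_eq_abs, abs_of_nonpos (by linarith)]
      ring
    refine ⟨by rw [mem_ball_iff_norm, hzc]; linarith, ?_⟩
    have hr1 : 0 < 1 - η := by linarith
    have h := norm_le_interp_of_mem_closedBall hr1 (by linarith) (by norm_num) hFd hinner houter
      (z := z) (by linarith) (by linarith)
    set θ := Real.log (‖z - c‖ / (1 - η)) / Real.log (5 / 4 / (1 - η)) with hθ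
    have hden : 1 / 5 ≤ Real.log (5 / 4 / (1 - η)) := by
      have h4 := Real.one_sub_inv_le_log_of_pos (show 0 < 5 / 4 / (1 - η) by positivity)
      rw [inv_div] at h4
      linarith
    have hnum0 : 0 ≤ Real.log (‖z - c‖ / (1 - η)) := by
      refine Real.log_nonneg ?_
      rw [le_div_iff₀ hr1]; linarith
    have hnum : Real.log (‖z - c‖ / (1 - η)) ≤ 2 * η := by
      have h5 : 0 < ‖z - c‖ / (1 - η) := div_pos (by linarith) hr1
      refine (Real.log_le_sub_one_of_pos h5).trans ?_
      rw [tsub_le_iff_right, div_le_iff₀ hr1]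
      nlinarith
    have hθ0 : 0 ≤ θ := div_nonneg hnum0 (by linarith)
    have hθ1 : θ ≤ 10 * η := by
      rw [hθ, div_le_iff₀ (by linarith)]
      nlinarith
    have ha1 : 1 ≤ (K₀ + 1) / η := by
      rw [le_div_iff₀ hη0]; linarith
    have hL1 : 1 ≤ L ^ 2 := by nlinarith
    refine h.trans ?_
    rw [mul_div_right_comm]
    refine mul_le_mul ?_ ?_ (by positivity) (by positivity)
    · calc ((K₀ + 1) / η) ^ (1 - θ) ≤ ((K₀ + 1) / η) ^ (1 : ℝ) :=
            Real.rpow_le_rpow_of_exponent_le ha1 (by linarith)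
        _ = _ := Real.rpow_one _
    · refine (Real.rpow_le_rpow_of_exponent_le hL1 hθ1).trans (le_of_eq ?_)
      rw [Real.rpow_def_of_pos (by linarith), Real.log_pow, hηL]
      congr 1
      field_simp
      norm_num
  have hz0 : (1 + τ * I : ℂ) ∈ Set.Icc (1 : ℝ) (1 + η) ×ℂ {τ} := by
    simp [Complex.mem_reProdIm, hη0.le]
  have hz1 : (((1 + η : ℝ) : ℂ) + τ * I) ∈ Set.Icc (1 : ℝ) (1 + η) ×ℂ {τ} := by
    simp [Complex.mem_reProdIm, hη0.le]
  have hmv := Convex.norm_image_sub_le_of_norm_deriv_le (𝕜 := ℂ) (f := g)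
    (s := Set.Icc (1 : ℝ) (1 + η) ×ℂ {τ}) (C := (K₀ + 1) * Real.exp 20 / η)
    (fun z hz ↦ (hg z (hseg z hz).1).differentiableAt)
    (fun z hz ↦ by rw [(hg z (hseg z hz).1).deriv]; exact (hseg z hz).2)
    (((convex_Icc (1 : ℝ) (1 + η)).linear_preimage Complex.reLm).inter
      ((convex_singleton τ).linear_preimage Complex.imLm)) hz1 hz0
  have hdist : ‖(1 + τ * I : ℂ) - (((1 + η : ℝ) : ℂ) + τ * I)‖ = η := by
    have : (1 + τ * I : ℂ) - (((1 + η : ℝ) : ℂ) + τ * I) = ((-η : ℝ) : ℂ) := by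
      push_cast; ring
    rw [this, Complex.norm_real, norm_neg, Real.norm_of_nonneg hη0.le]
  rw [hdist, div_mul_cancel₀ _ hη0.ne'] at hmv
  have hre := (Complex.re_le_norm _).trans hmv
  rw [Complex.sub_re] at hre
  rw [hexp _ (hseg _ hz0).1, hexp _ (hseg _ hz1).1, norm_mul, norm_mul, Complex.norm_exp,
    Complex.norm_exp, mul_left_comm, ← Real.exp_add]
  gcongr
  linarith

/-- On a vertical line in the half-plane of absolute convergence, `log |ζ|` is a cosine series with
nonnegative coefficients. -/
theorem exists_norm_riemannZeta_eq_exp_cos_series {σ : ℝ} (hσ : 1 < σ) :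
    ∃ c l : Nat.Primes × ℕ → ℝ, (∀ i, 0 ≤ c i) ∧ Summable c ∧
      ∀ t : ℝ, ‖riemannZeta ((σ : ℂ) + t * I)‖ = Real.exp (∑' i, c i * Real.cos (l i * t)) := by
  set c : Nat.Primes × ℕ → ℝ := fun i ↦ ((i.1 : ℕ) : ℝ) ^ (-σ * i.2) / i.2 with hc
  set l : Nat.Primes × ℕ → ℝ := fun i ↦ i.2 * Real.log ((i.1 : ℕ) : ℝ) with hl
  have hc0 (i) : 0 ≤ c i := by positivity
  have hre (t : ℝ) : 1 < ((σ : ℂ) + t * I).re := by simpa using hσ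
  have hterm (t : ℝ) (p : Nat.Primes) : HasSum (fun n : ℕ ↦ c (p, n) * Real.cos (l (p, n) * t))
      (-Complex.log (1 - ((p : ℕ) : ℂ) ^ (-((σ : ℂ) + t * I)))).re := by
    have hp0 : 0 < ((p : ℕ) : ℝ) := by exact_mod_cast p.prop.pos
    have hz : ‖((p : ℕ) : ℂ) ^ (-((σ : ℂ) + t * I))‖ < 1 := by
      rw [Complex.norm_natCast_cpow_of_pos p.prop.pos, Complex.neg_re]
      exact Real.rpow_lt_one_of_one_lt_of_neg (by exact_mod_cast p.prop.one_lt)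
        (by linarith [hre t])
    refine (congrArg (fun f ↦ HasSum f _) (funext fun n ↦ ?_)).mpr
      (Complex.hasSum_re (Complex.hasSum_taylorSeries_neg_log hz))
    have h1 : (((p : ℕ) : ℂ) ^ (-((σ : ℂ) + t * I))) ^ n =
        (((((p : ℕ) : ℝ) ^ (-σ * n) : ℝ)) : ℂ) *
          cexp ((-(n * Real.log (p : ℕ) * t) : ℝ) * I) := by
      rw [Real.rpow_def_of_pos hp0, Complex.ofReal_exp, ← Complex.exp_add,
        Complex.cpow_def_of_ne_zero (by exact_mod_cast hp0.ne'), ← Complex.exp_nat_mul,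
        ← Complex.ofReal_natCast (p : ℕ), ← Complex.ofReal_log hp0.le]
      congr 1
      push_cast
      ring
    rw [h1, ← Complex.ofReal_natCast n, Complex.div_ofReal_re, Complex.re_ofReal_mul,
      Complex.exp_ofReal_mul_I_re, Real.cos_neg]
    simp only [hc, hl]
    ring
  have hlog (t : ℝ) : Summable fun p : Nat.Primes ↦
      -Complex.log (1 - ((p : ℕ) : ℂ) ^ (-((σ : ℂ) + t * I))) := by
    have := DirichletCharacter.summable_neg_log_one_sub_mul_prime_cpow
      (1 : DirichletCharacter ℂ 1) (hre t)
    refine this.congr fun p ↦ ?_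
    rw [MulChar.one_apply (isUnit_of_subsingleton _), one_mul]
  have hcs : Summable c := by
    have hp (p : Nat.Primes) := by simpa using hterm 0 p
    refine (summable_prod_of_nonneg hc0).2 ⟨fun p ↦ (hp p).summable, ?_⟩
    simp only [fun p ↦ (hp p).tsum_eq]
    simpa using (Complex.hasSum_re (hlog 0).hasSum).summable
  refine ⟨c, l, hc0, hcs, fun t ↦ ?_⟩
  have hsum : Summable fun i ↦ c i * Real.cos (l i * t) :=
    Summable.of_norm_bounded hcs fun i ↦ by
      rw [norm_mul, Real.norm_of_nonneg (hc0 i)]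
      exact mul_le_of_le_one_right (hc0 i) (Real.abs_cos_le_one _)
  rw [← riemannZeta_eulerProduct_exp_log (hre t), Complex.norm_exp,
    (Complex.hasSum_re (hlog t).hasSum).tsum_eq.symm, hsum.tsum_prod]
  congr 1
  exact tsum_congr fun p ↦ (hterm t p).tsum_eq.symm

theorem norm_fourier_gaussian_le_re (ξ : ℝ) :
    ‖∫ t : ℝ, ((Real.exp (-t ^ 2) : ℝ) : ℂ) * cexp (I * (ξ * t : ℝ))‖ ≤
      (∫ t : ℝ, ((Real.exp (-t ^ 2) : ℝ) : ℂ) * cexp (I * (ξ * t : ℝ))).re := by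
  have h := fourierIntegral_gaussian (b := 1) (by simp) ξ
  have h1 : ∫ t : ℝ, ((Real.exp (-t ^ 2) : ℝ) : ℂ) * cexp (I * (ξ * t : ℝ)) =
      ((π ^ (1 / 2 : ℝ) * Real.exp (-ξ ^ 2 / 4) : ℝ) : ℂ) := by
    rw [Complex.ofReal_mul, Complex.ofReal_cpow Real.pi_pos.le]
    push_cast
    rw [show ((π : ℂ) ^ (1 / 2 : ℂ)) * cexp (-(ξ : ℂ) ^ 2 / 4) =
      (π / 1 : ℂ) ^ (1 / 2 : ℂ) * cexp (-(ξ : ℂ) ^ 2 / (4 * 1)) by simp, ← h]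
    congr 1
    funext t
    rw [mul_comm, neg_one_mul, mul_assoc]
  rw [h1, Complex.norm_real, Complex.ofReal_re, Real.norm_of_nonneg (by positivity)]

theorem integrable_exp_neg_sq : Integrable fun t : ℝ ↦ Real.exp (-t ^ 2) := by
  simpa using integrable_exp_neg_mul_sq one_pos

/-- Weighted mean of `ζ` on vertical segments close to the pole. -/
theorem exists_integral_norm_riemannZeta_le :
    ∃ A > (0 : ℝ), ∀ η : ℝ, 0 < η → η ≤ 1 / 2 →
      ∫ t : ℝ, ‖riemannZeta (((1 + η : ℝ) : ℂ) + t * I)‖ * Real.exp (-t ^ 2) ≤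
        A * (Real.log (1 / η) + 1) := by
  set B := ∫ t : ℝ, (8 + |t|) * Real.exp (-t ^ 2) with hB
  have hBint : Integrable fun t : ℝ ↦ (8 + |t|) * Real.exp (-t ^ 2) := by
    have h1 : Integrable fun t : ℝ ↦ |t| * Real.exp (-t ^ 2) := by
      have := (integrable_mul_exp_neg_mul_sq (b := 1) one_pos).norm
      refine this.congr (Eventually.of_forall fun t ↦ ?_)
      simp
    simp only [add_mul]
    exact (integrable_exp_neg_sq.const_mul 8).add h1
  have hB0 : 0 ≤ B := integral_nonneg fun t ↦ by positivity
  refine ⟨B + 8, by positivity, fun η hη hη2 ↦ ?_⟩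
  set f : ℝ → ℝ := (Set.Iic (1 : ℝ)).indicator fun u ↦ 4 / (η + u) with hf
  have hf0 {u : ℝ} (hu : 0 ≤ u) : 0 ≤ f u := by
    by_cases h : u ≤ 1
    · rw [hf, Set.indicator_of_mem (by exact h)]
      positivity
    · rw [hf, Set.indicator_of_notMem (by exact h)]
  have hfabs : (fun t ↦ f |t|) = (Set.Icc (-1 : ℝ) 1).indicator fun t ↦ 4 / (η + |t|) := by
    funext t
    by_cases ht : |t| ≤ 1
    · rw [hf, Set.indicator_of_mem (by exact ht), Set.indicator_of_mem (by exact abs_le.1 ht)]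
    · rw [hf, Set.indicator_of_notMem (by exact ht),
        Set.indicator_of_notMem (show t ∉ Set.Icc (-1 : ℝ) 1 from fun h ↦ ht (abs_le.2 h))]
  have hfint : Integrable fun t ↦ f |t| := by
    rw [hfabs, integrable_indicator_iff measurableSet_Icc]
    refine ContinuousOn.integrableOn_compact isCompact_Icc (Continuous.continuousOn ?_)
    exact continuous_const.div (continuous_const.add continuous_abs) fun t ↦ by positivity
  have hfval : ∫ t, f |t| = 8 * Real.log ((η + 1) / η) := by
    rw [integral_comp_abs, hf, setIntegral_indicator measurableSet_Iic, Set.Ioi_inter_Iic,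
      ← intervalIntegral.integral_of_le zero_le_one]
    have := intervalIntegral.integral_comp_add_left (a := 0) (b := 1)
      (fun u : ℝ ↦ 4 * (1 / u)) η
    simp only [mul_one_div] at this
    rw [this]
    simp only [div_eq_mul_one_div (4 : ℝ)]
    rw [intervalIntegral.integral_const_mul, integral_one_div_of_pos (by linarith) (by linarith),
      add_zero]
    ring
  have hpt (t : ℝ) : ‖riemannZeta (((1 + η : ℝ) : ℂ) + t * I)‖ * Real.exp (-t ^ 2) ≤
      (8 + |t|) * Real.exp (-t ^ 2) + f |t| := by
    set s : ℂ := ((1 + η : ℝ) : ℂ) + t * I with hs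
    have hsre : s.re = 1 + η := by simp [hs]
    have ht := abs_nonneg t
    have h1 : ‖s‖ ≤ 2 + |t| := by
      refine (norm_add_le _ _).trans ?_
      rw [norm_mul, Complex.norm_I, mul_one, Complex.norm_real, Complex.norm_real,
        Real.norm_of_nonneg (by linarith), Real.norm_eq_abs]
      linarith
    have h2 : (η + |t|) / 2 ≤ ‖s - 1‖ := by
      have hr := (le_abs_self _).trans (Complex.abs_re_le_norm (s - 1))
      have hi := Complex.abs_im_le_norm (s - 1)
      simp [hs] at hr hi
      simp [hs]
      linarith
    have h3 : 1 / s.re ≤ 1 := by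
      rw [hsre, div_le_one (by linarith)]; linarith
    have h4 : ‖riemannZeta s‖ ≤ 4 + |t| + 4 / (η + |t|) := by
      have h5 : 0 < η + |t| := by linarith
      have h6 : 0 < s.re := by linarith
      calc ‖riemannZeta s‖ ≤ ‖s‖ * (1 / ‖s - 1‖ + 1 / s.re) :=
            norm_riemannZeta_le (Or.inl (by linarith))
        _ ≤ (2 + |t|) * (1 / ((η + |t|) / 2) + 1) := by gcongr
        _ ≤ _ := by
          rw [← sub_nonneg]
          have : 4 + |t| + 4 / (η + |t|) - (2 + |t|) * (1 / ((η + |t|) / 2) + 1) =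
              2 * η / (η + |t|) := by
            field_simp
            ring
          rw [this]
          positivity
    have he0 := Real.exp_pos (-t ^ 2)
    have he1 : Real.exp (-t ^ 2) ≤ 1 := Real.exp_le_one_iff.2 (by nlinarith)
    by_cases h6 : |t| ≤ 1
    · have h7 : f |t| = 4 / (η + |t|) := Set.indicator_of_mem (by exact h6) _
      have h8 : 0 ≤ 4 / (η + |t|) := by positivity
      rw [h7]
      nlinarith
    · have h8 : 4 / (η + |t|) ≤ 4 := by
        rw [div_le_iff₀ (by linarith)]
        nlinarith
      have := hf0 ht
      nlinarith
  calc ∫ t : ℝ, ‖riemannZeta (((1 + η : ℝ) : ℂ) + t * I)‖ * Real.exp (-t ^ 2)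
      ≤ ∫ t : ℝ, ((8 + |t|) * Real.exp (-t ^ 2) + f |t|) :=
        integral_mono_of_nonneg (Eventually.of_forall fun t ↦ by positivity) (hBint.add hfint)
          (Eventually.of_forall hpt)
    _ = B + 8 * Real.log ((η + 1) / η) := by rw [integral_add hBint hfint, hfval]
    _ ≤ (B + 8) * (Real.log (1 / η) + 1) := by
        have h1 : Real.log ((η + 1) / η) ≤ Real.log (1 / η) + 1 := by
          rw [div_eq_mul_one_div, Real.log_mul (by positivity) (by positivity)]
          have := Real.log_le_sub_one_of_pos (show 0 < η + 1 by positivity)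
          linarith
        have h2 : 0 ≤ Real.log (1 / η) := Real.log_nonneg (by
          rw [le_div_iff₀ hη]; linarith)
        nlinarith

/-- A short mean of `|ζ|` to the right of the line `re s = 1` is dominated by a weighted mean
centred at the real axis. -/
theorem integral_norm_riemannZeta_le {σ δ : ℝ} (hσ : 1 < σ) (hδ : 0 ≤ δ) (T : ℝ) :
    ∫ t in T..(T + δ), ‖riemannZeta ((σ : ℂ) + t * I)‖ ≤
      Real.exp (δ ^ 2) * ∫ t : ℝ, ‖riemannZeta ((σ : ℂ) + t * I)‖ * Real.exp (-t ^ 2) := by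
  obtain ⟨c, l, hc0, hc, hζ⟩ := exists_norm_riemannZeta_eq_exp_cos_series hσ
  simp only [hζ]
  have hcont : Continuous fun t ↦ Real.exp (∑' i, c i * Real.cos (l i * t)) :=
    Real.continuous_exp.comp (continuous_cos_series hc0 hc)
  have hcontT : Continuous fun t ↦ Real.exp (∑' i, c i * Real.cos (l i * (T + t))) :=
    hcont.comp (continuous_const.add continuous_id)
  have hint : Integrable fun t ↦
      Real.exp (∑' i, c i * Real.cos (l i * (T + t))) * Real.exp (-t ^ 2) := by
    refine integrable_exp_neg_sq.bdd_mul (c := Real.exp (∑' i, c i))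
      hcontT.aestronglyMeasurable (Eventually.of_forall fun t ↦ ?_)
    rw [Real.norm_of_nonneg (Real.exp_pos _).le]
    exact Real.exp_le_exp.2 ((le_abs_self _).trans (norm_cos_series_le hc0 hc _))
  have hshift : ∫ t in T..(T + δ), Real.exp (∑' i, c i * Real.cos (l i * t)) =
      ∫ t in (0 : ℝ)..δ, Real.exp (∑' i, c i * Real.cos (l i * (T + t))) := by
    have := intervalIntegral.integral_comp_add_left (a := 0) (b := δ)
      (fun t ↦ Real.exp (∑' i, c i * Real.cos (l i * t))) T
    rw [this, add_zero]
  rw [hshift]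
  calc ∫ t in (0 : ℝ)..δ, Real.exp (∑' i, c i * Real.cos (l i * (T + t)))
      ≤ ∫ t in (0 : ℝ)..δ, Real.exp (δ ^ 2) *
          (Real.exp (∑' i, c i * Real.cos (l i * (T + t))) * Real.exp (-t ^ 2)) := by
        refine intervalIntegral.integral_mono_on hδ (hcontT.intervalIntegrable _ _)
          ((hint.const_mul _).intervalIntegrable) fun t ht ↦ ?_
        rw [mul_left_comm, ← Real.exp_add]
        refine le_mul_of_one_le_right (Real.exp_pos _).le (Real.one_le_exp ?_)
        nlinarith [ht.1, ht.2]
    _ = Real.exp (δ ^ 2) * ∫ t in (0 : ℝ)..δ,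
          Real.exp (∑' i, c i * Real.cos (l i * (T + t))) * Real.exp (-t ^ 2) :=
        intervalIntegral.integral_const_mul _ _
    _ ≤ Real.exp (δ ^ 2) * ∫ t,
          Real.exp (∑' i, c i * Real.cos (l i * (T + t))) * Real.exp (-t ^ 2) := by
        rw [intervalIntegral.integral_of_le hδ]
        refine mul_le_mul_of_nonneg_left ?_ (Real.exp_pos _).le
        exact setIntegral_le_integral hint (Eventually.of_forall fun t ↦ by positivity)
    _ ≤ _ := by
        refine mul_le_mul_of_nonneg_left ?_ (Real.exp_pos _).le
        exact integral_exp_cos_series_translate_le (l := l) hc0 hc integrable_exp_neg_sq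
          norm_fourier_gaussian_le_re T

theorem stmt_8 (hRH : RiemannHypothesis) (δ : ℝ) (hδ : 0 < δ) :
    ∃ C > (0 : ℝ), ∃ T₀ : ℝ, (16 : ℝ) ≤ T₀ ∧ ∀ T : ℝ, T₀ ≤ T →
      (∫ t in T..(T + δ), ‖riemannZeta (1 + t * Complex.I)‖ ^ ((1 : ℝ))) ≤ C * Real.log (Real.log (Real.log T)) := by
  obtain ⟨K, hK, hcomp⟩ := exists_norm_riemannZeta_one_add_le hRH
  obtain ⟨A, hA, hmean⟩ := exists_integral_norm_riemannZeta_le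
  have hll := Real.tendsto_log_atTop.comp Real.tendsto_log_atTop
  have hlll := Real.tendsto_log_atTop.comp hll
  obtain ⟨T₁, hT₁⟩ := eventually_atTop.1 ((Real.tendsto_log_atTop.eventually_ge_atTop 2816).and
    ((hll.eventually_ge_atTop 2).and (hlll.eventually_ge_atTop 1)))
  refine ⟨K * (Real.exp (δ ^ 2) * (A * 2)), by positivity, max T₁ (max 18 δ),
    le_max_of_le_right (le_max_of_le_left (by norm_num)), fun T hT ↦ ?_⟩
  obtain ⟨hL, hM, hN⟩ := hT₁ T ((le_max_left _ _).trans hT)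
  have hT18 : 18 ≤ T := ((le_max_left _ _).trans (le_max_right _ _)).trans hT
  have hTδ : δ ≤ T := ((le_max_right _ _).trans (le_max_right _ _)).trans hT
  simp only [Function.comp_apply] at hM hN
  set η := 1 / Real.log (Real.log T) with hη
  have hη0 : 0 < η := by positivity
  have hη2 : η ≤ 1 / 2 := one_div_le_one_div_of_le two_pos hM
  have hη1 : 1 < 1 + η := by linarith
  have hcont (σ : ℝ) : ContinuousOn (fun t : ℝ ↦ ‖riemannZeta ((σ : ℂ) + t * I)‖)
      (Set.uIcc T (T + δ)) := by
    intro t ht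
    rw [Set.uIcc_of_le (by linarith)] at ht
    have hne : (σ : ℂ) + t * I ≠ 1 := by
      intro h
      have := congrArg Complex.im h
      simp at this
      linarith [ht.1]
    refine (ContinuousAt.norm ?_).continuousWithinAt
    exact (differentiableAt_riemannZeta hne).continuousAt.comp (f := fun t : ℝ ↦ (σ : ℂ) + t * I)
      (by fun_prop)
  have hcont1 := hcont 1
  rw [Complex.ofReal_one] at hcont1
  simp only [Real.rpow_one]
  calc ∫ t in T..(T + δ), ‖riemannZeta (1 + t * I)‖
      ≤ ∫ t in T..(T + δ), K * ‖riemannZeta (((1 + η : ℝ) : ℂ) + t * I)‖ := by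
        refine intervalIntegral.integral_mono_on (by linarith) hcont1.intervalIntegrable
          ((hcont _).intervalIntegrable.const_mul _) fun t ht ↦ ?_
        refine hcomp (Real.log T) η t hL hη hη2 (by linarith [ht.1]) ?_
        have h1 : Real.log t ≤ Real.log (T ^ 2) :=
          Real.log_le_log (by linarith [ht.1]) (by nlinarith [ht.2])
        rw [Real.log_pow] at h1
        exact_mod_cast h1
    _ = K * ∫ t in T..(T + δ), ‖riemannZeta (((1 + η : ℝ) : ℂ) + t * I)‖ :=
        intervalIntegral.integral_const_mul _ _
    _ ≤ K * (Real.exp (δ ^ 2) * (A * (Real.log (1 / η) + 1))) := by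
        gcongr
        exact (integral_norm_riemannZeta_le hη1 hδ.le T).trans
          (mul_le_mul_of_nonneg_left (hmean η hη0 hη2) (Real.exp_pos _).le)
    _ ≤ K * (Real.exp (δ ^ 2) * (A * (2 * Real.log (Real.log (Real.log T))))) := by
        have : 1 / η = Real.log (Real.log T) := by rw [hη, one_div_one_div]
        rw [this]
        gcongr
        linarith
    _ = K * (Real.exp (δ ^ 2) * (A * 2)) * Real.log (Real.log (Real.log T)) := by ring
end

section
/- For every δ > 0 there exist constants C > 0 and T₀ ≥ 3 such that for all T ≥ T₀, ∫_T^{T+δ} |ζ(1+it)| dt ≤ C · log log T. -/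
open Complex Real Filter MeasureTheory intervalIntegral

lemma double_integral_sq_norm_exp_sum (s : Finset ℕ) (l : ℕ → ℝ) (b : ℕ → ℂ) (L : ℝ) :
    ((∫ y in (0 : ℝ)..L, ∫ x in (0 : ℝ)..L,
      ‖∑ n ∈ s, b n * cexp (-((x - y : ℝ) * l n * I))‖ ^ 2 : ℝ) : ℂ) =
    ∑ n ∈ s, ∑ m ∈ s, b n * (starRingEnd ℂ) (b m) *
      ((‖∫ x in (0 : ℝ)..L, cexp (-(x * (l n - l m) * I))‖ ^ 2 : ℝ) : ℂ) := by
  have key : ∀ x y : ℝ, ((‖∑ n ∈ s, b n * cexp (-((x - y : ℝ) * l n * I))‖ ^ 2 : ℝ) : ℂ) =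
      ∑ n ∈ s, ∑ m ∈ s, (b n * (starRingEnd ℂ) (b m) *
        (starRingEnd ℂ) (cexp (-(y * (l n - l m) * I)))) * cexp (-(x * (l n - l m) * I)) := by
    intro x y
    rw [ofReal_pow, ← Complex.mul_conj', map_sum, Finset.sum_mul_sum]
    refine Finset.sum_congr rfl fun n _ => Finset.sum_congr rfl fun m _ => ?_
    rw [map_mul, ← Complex.exp_conj, ← Complex.exp_conj]
    simp only [map_neg, map_mul, map_sub, conj_ofReal, conj_I]
    have : cexp (-((x - y : ℝ) * l n * I)) * cexp (-((x - y : ℝ) * l m * -I)) =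
        cexp (-(y * (l n - l m) * -I)) * cexp (-(x * (l n - l m) * I)) := by
      rw [← Complex.exp_add, ← Complex.exp_add]
      congr 1
      push_cast
      ring
    linear_combination (b n * (starRingEnd ℂ) (b m)) * this
  rw [← intervalIntegral.integral_ofReal]
  simp_rw [← intervalIntegral.integral_ofReal, key]
  have inner : ∀ y : ℝ, (∫ x in (0 : ℝ)..L, ∑ n ∈ s, ∑ m ∈ s, (b n * (starRingEnd ℂ) (b m) *
        (starRingEnd ℂ) (cexp (-(y * (l n - l m) * I)))) * cexp (-(x * (l n - l m) * I))) =
      ∑ n ∈ s, ∑ m ∈ s, (b n * (starRingEnd ℂ) (b m) *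
        ∫ x in (0 : ℝ)..L, cexp (-(x * (l n - l m) * I))) *
          (starRingEnd ℂ) (cexp (-(y * (l n - l m) * I))) := by
    intro y
    rw [intervalIntegral.integral_finsetSum
      fun n _ => Continuous.intervalIntegrable (by fun_prop) _ _]
    refine Finset.sum_congr rfl fun n _ => ?_
    rw [intervalIntegral.integral_finsetSum
      fun n _ => Continuous.intervalIntegrable (by fun_prop) _ _]
    refine Finset.sum_congr rfl fun m _ => ?_
    rw [intervalIntegral.integral_const_mul]
    ring
  simp_rw [inner]
  have hc : Continuous (starRingEnd ℂ) := Complex.continuous_conj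
  rw [intervalIntegral.integral_finsetSum
      fun n _ => Continuous.intervalIntegrable (by fun_prop) _ _]
  refine Finset.sum_congr rfl fun n _ => ?_
  rw [intervalIntegral.integral_finsetSum
    fun n _ => Continuous.intervalIntegrable (by fun_prop) _ _]
  refine Finset.sum_congr rfl fun m _ => ?_
  rw [intervalIntegral.integral_const_mul, ofReal_pow, ← Complex.mul_conj']
  simp only [intervalIntegral, map_sub, ← integral_conj]
  ring

lemma double_integral_sq_norm_exp_sum_le (s : Finset ℕ) (l : ℕ → ℝ) (a : ℕ → ℝ) (b : ℕ → ℂ)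
    (hab : ∀ n, ‖b n‖ ≤ a n) (L : ℝ) :
    (∫ y in (0 : ℝ)..L, ∫ x in (0 : ℝ)..L,
      ‖∑ n ∈ s, b n * cexp (-((x - y : ℝ) * l n * I))‖ ^ 2) ≤
    ∫ y in (0 : ℝ)..L, ∫ x in (0 : ℝ)..L,
      ‖∑ n ∈ s, (a n : ℂ) * cexp (-((x - y : ℝ) * l n * I))‖ ^ 2 := by
  have h1 := double_integral_sq_norm_exp_sum s l b L
  have h2 := double_integral_sq_norm_exp_sum s l (fun n => (a n : ℂ)) L
  have h3 : (∫ y in (0 : ℝ)..L, ∫ x in (0 : ℝ)..L,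
      ‖∑ n ∈ s, (a n : ℂ) * cexp (-((x - y : ℝ) * l n * I))‖ ^ 2) =
      ∑ n ∈ s, ∑ m ∈ s, a n * a m *
        ‖∫ x in (0 : ℝ)..L, cexp (-(x * (l n - l m) * I))‖ ^ 2 := by
    apply Complex.ofReal_injective
    rw [h2]
    push_cast
    simp
  rw [h3]
  refine (le_abs_self _).trans ?_
  rw [← Real.norm_eq_abs, ← Complex.norm_real, h1]
  refine (norm_sum_le _ _).trans (Finset.sum_le_sum fun n _ => (norm_sum_le _ _).trans
    (Finset.sum_le_sum fun m _ => ?_))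
  rw [norm_mul, norm_mul, RCLike.norm_conj, Complex.norm_real, Real.norm_of_nonneg (sq_nonneg _)]
  gcongr
  · exact (norm_nonneg _).trans (hab n)
  · exact hab n
  · exact hab m

lemma double_integral_sub_le {F : ℝ → ℝ} (hF : Continuous F) (h0 : ∀ x, 0 ≤ F x) {L : ℝ}
    (hL : 0 ≤ L) :
    (∫ y in (0 : ℝ)..L, ∫ x in (0 : ℝ)..L, F (x - y)) ≤ L * ∫ x in (-L)..L, F x := by
  have h : ∀ y ∈ Set.Icc 0 L, (∫ x in (0 : ℝ)..L, F (x - y)) ≤ ∫ x in (-L)..L, F x := by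
    intro y hy
    rw [intervalIntegral.integral_comp_sub_right F y]
    exact integral_mono_interval (by linarith [hy.2]) (by linarith) (by linarith [hy.1])
      (Eventually.of_forall h0) (hF.intervalIntegrable _ _)
  have := intervalIntegral.integral_mono_on (μ := volume) hL ?_ (by simp) h
  · simpa using this
  · refine Continuous.intervalIntegrable ?_ _ _
    fun_prop

lemma le_double_integral_sub {F : ℝ → ℝ} (hF : Continuous F) (h0 : ∀ x, 0 ≤ F x) {d : ℝ}
    (hd : 0 ≤ d) :
    d * (∫ x in (0 : ℝ)..d, F x) ≤
      ∫ y in (0 : ℝ)..(2 * d), ∫ x in (0 : ℝ)..(2 * d), F (x - y) := by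
  have hc : Continuous fun y => ∫ x in (0 : ℝ)..(2 * d), F (x - y) := by fun_prop
  have h : ∀ y ∈ Set.Icc 0 d,
      (∫ x in (0 : ℝ)..d, F x) ≤ ∫ x in (0 : ℝ)..(2 * d), F (x - y) := by
    intro y hy
    rw [intervalIntegral.integral_comp_sub_right F y]
    exact integral_mono_interval (by linarith [hy.1]) (by linarith) (by linarith [hy.2])
      (Eventually.of_forall h0) (hF.intervalIntegrable _ _)
  have := intervalIntegral.integral_mono_on (μ := volume) hd (by simp)
    (hc.intervalIntegrable _ _) h
  rw [intervalIntegral.integral_const, sub_zero, smul_eq_mul] at this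
  refine this.trans ?_
  refine integral_mono_interval (c := 0) (d := 2 * d) (μ := volume) le_rfl hd (by linarith)
      (Eventually.of_forall fun y => ?_) (hc.intervalIntegrable _ _)
  exact intervalIntegral.integral_nonneg (by linarith) fun x _ => h0 _

lemma integral_sq_norm_exp_sum_le (s : Finset ℕ) (l : ℕ → ℝ) (a : ℕ → ℝ) (ha : ∀ n, 0 ≤ a n)
    (c d : ℝ) (hd : 0 < d) :
    (∫ x in c..(c + d), ‖∑ n ∈ s, (a n : ℂ) * cexp (-(x * l n * I))‖ ^ 2) ≤
    2 * ∫ x in (-(2 * d))..(2 * d), ‖∑ n ∈ s, (a n : ℂ) * cexp (-(x * l n * I))‖ ^ 2 := by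
  let b : ℕ → ℂ := fun n => (a n : ℂ) * cexp (-(c * l n * I))
  have hab : ∀ n, ‖b n‖ ≤ a n := by
    intro n
    have : -(c * l n * I) = ((-(c * l n) : ℝ) : ℂ) * I := by push_cast; ring
    simp only [b]
    rw [norm_mul, this, Complex.norm_exp_ofReal_mul_I, mul_one, Complex.norm_real,
      Real.norm_of_nonneg (ha n)]
  have hshift : (∫ x in c..(c + d), ‖∑ n ∈ s, (a n : ℂ) * cexp (-(x * l n * I))‖ ^ 2) =
      ∫ x in (0 : ℝ)..d, ‖∑ n ∈ s, b n * cexp (-(x * l n * I))‖ ^ 2 := by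
    have := intervalIntegral.integral_comp_add_right (a := 0) (b := d)
      (fun x : ℝ => ‖∑ n ∈ s, (a n : ℂ) * cexp (-(x * l n * I))‖ ^ 2) c
    rw [zero_add, add_comm d c] at this
    rw [← this]
    congr 1 with x
    congr 2
    refine Finset.sum_congr rfl fun n _ => ?_
    simp only [b]
    rw [mul_assoc (a n : ℂ), ← Complex.exp_add]
    congr 2
    push_cast
    ring
  rw [hshift]
  have h1 := le_double_integral_sub
    (F := fun x : ℝ => ‖∑ n ∈ s, b n * cexp (-(x * l n * I))‖ ^ 2) (by fun_prop)
    (fun x => sq_nonneg _) hd.le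
  have h2 := double_integral_sq_norm_exp_sum_le s l a b hab (2 * d)
  have h3 := double_integral_sub_le
    (F := fun x : ℝ => ‖∑ n ∈ s, (a n : ℂ) * cexp (-(x * l n * I))‖ ^ 2) (by fun_prop)
    (fun x => sq_nonneg _) (L := 2 * d) (by linarith)
  have h4 := h1.trans (h2.trans h3)
  refine le_of_mul_le_mul_left (h4.trans_eq (by ring)) hd

lemma integral_sq_norm_exp_tsum_le (l : ℕ → ℝ) (a : ℕ → ℝ) (ha : ∀ n, 0 ≤ a n)
    (hs : Summable a) (c d : ℝ) (hd : 0 < d) :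
    (∫ x in c..(c + d), ‖∑' n, (a n : ℂ) * cexp (-(x * l n * I))‖ ^ 2) ≤
    2 * ∫ x in (-(2 * d))..(2 * d), ‖∑' n, (a n : ℂ) * cexp (-(x * l n * I))‖ ^ 2 := by
  have hn : ∀ (x : ℝ) n, ‖(a n : ℂ) * cexp (-(x * l n * I))‖ = a n := by
    intro x n
    have : -(x * l n * I) = ((-(x * l n) : ℝ) : ℂ) * I := by push_cast; ring
    rw [norm_mul, this, Complex.norm_exp_ofReal_mul_I, mul_one, Complex.norm_real,
      Real.norm_of_nonneg (ha n)]
  have lim : ∀ u v : ℝ, Tendsto (fun N : ℕ => ∫ x in u..v,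
      ‖∑ n ∈ Finset.range N, (a n : ℂ) * cexp (-(x * l n * I))‖ ^ 2) atTop
      (nhds (∫ x in u..v, ‖∑' n, (a n : ℂ) * cexp (-(x * l n * I))‖ ^ 2)) := by
    intro u v
    refine intervalIntegral.tendsto_integral_filter_of_dominated_convergence
      (fun _ => (∑' n, a n) ^ 2) (Eventually.of_forall fun N => ?_)
      (Eventually.of_forall fun N => Eventually.of_forall fun x _ => ?_) (by simp)
      (Eventually.of_forall fun x _ => ?_)
    · exact Continuous.aestronglyMeasurable (by fun_prop)
    · rw [Real.norm_of_nonneg (sq_nonneg _)]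
      gcongr
      refine (norm_sum_le _ _).trans ?_
      simp_rw [hn]
      exact hs.sum_le_tsum _ fun n _ => ha n
    · have : Summable fun n => (a n : ℂ) * cexp (-(x * l n * I)) :=
        Summable.of_norm (by simpa only [hn] using hs)
      exact (this.hasSum.tendsto_sum_nat.norm).pow 2
  exact le_of_tendsto_of_tendsto' (lim _ _) ((lim _ _).const_mul 2)
    fun N => integral_sq_norm_exp_sum_le _ l a ha c d hd

/-- Majorant principle: for nonnegative coefficients, the mean square of an L-series over any
vertical segment of length `d` is controlled by the one around the real axis. -/
lemma integral_sq_norm_LSeries_le (f : ℕ → ℂ) (g : ℕ → ℝ) (hfg : ∀ n, f n = g n)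
    (hg : ∀ n, 0 ≤ g n) {σ : ℝ}
    (hs : LSeriesSummable f σ) (c d : ℝ) (hd : 0 < d) :
    (∫ x in c..(c + d), ‖LSeries f (σ + x * I)‖ ^ 2) ≤
    2 * ∫ x in (-(2 * d))..(2 * d), ‖LSeries f (σ + x * I)‖ ^ 2 := by
  let a : ℕ → ℝ := fun n => ‖LSeries.term f σ n‖
  have key : ∀ x : ℝ, LSeries f (σ + x * I) =
      ∑' n, (a n : ℂ) * cexp (-(x * (Real.log n) * I)) := by
    intro x
    refine tsum_congr fun n => ?_
    rcases eq_or_ne n 0 with rfl | hn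
    · simp [a]
    · simp only [a, LSeries.term_of_ne_zero hn, hfg]
      have hn0 : (n : ℂ) ≠ 0 := by exact_mod_cast hn
      have hnp : (0 : ℝ) < n := by positivity
      rw [norm_div, Complex.norm_natCast_cpow_of_pos (by positivity), Complex.norm_real,
        Real.norm_of_nonneg (hg n), Complex.cpow_add _ _ hn0, ofReal_re, ofReal_div,
        ofReal_cpow hnp.le, ofReal_natCast, Complex.exp_neg, Complex.cpow_def_of_ne_zero hn0 (x * I),
        ← Complex.natCast_log, div_mul_eq_div_div, div_eq_mul_inv _ (cexp _)]
      congr 3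
      ring
  simp_rw [key]
  exact integral_sq_norm_exp_tsum_le (fun n => Real.log n) a (fun n => norm_nonneg _)
    hs.norm c d hd

lemma exists_riemannZeta_pole_bound (R : ℝ) : ∃ M > (0 : ℝ), ∀ σ t : ℝ, 1 < σ → σ ≤ 2 →
    t ∈ Set.Icc (-R) R →
    ‖riemannZeta (σ + t * I)‖ ≤ M / ‖(σ - 1 : ℂ) + t * I‖ ∧
    ‖deriv riemannZeta (σ + t * I) / riemannZeta (σ + t * I)‖ ≤ M / ‖(σ - 1 : ℂ) + t * I‖ := by
  have hne : ∀ s : ℂ, 1 ≤ s.re → riemannZeta₁ s ≠ 0 := by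
    intro s hs
    rcases eq_or_ne s 1 with rfl | h1
    · simp
    · have := riemannZeta_ne_zero_of_one_le_re hs
      rw [riemannZeta_eq_inv_sub_mul h1] at this
      exact right_ne_zero_of_mul this
  have hK : IsCompact (Set.Icc (1 : ℝ) 2 ×ℂ Set.Icc (-R) R) := isCompact_Icc.reProdIm isCompact_Icc
  have hd : Differentiable ℂ riemannZeta₁ := differentiable_riemannZeta₁
  obtain ⟨A, hA⟩ := hK.exists_bound_of_continuousOn hd.continuous.continuousOn
  obtain ⟨B, hB⟩ := hK.exists_bound_of_continuousOn
    (f := fun s => -1 + (s - 1) * (deriv riemannZeta₁ s / riemannZeta₁ s)) (by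
      refine continuousOn_const.add ((by fun_prop : ContinuousOn (fun s : ℂ => s - 1) _).mul ?_)
      exact hd.deriv.continuous.continuousOn.div hd.continuous.continuousOn
        fun s hs => hne s (mem_reProdIm.1 hs).1.1)
  refine ⟨max 1 (max A B), by positivity, fun σ t h1 h2 ht => ?_⟩
  have hmem : (σ + t * I : ℂ) ∈ Set.Icc (1 : ℝ) 2 ×ℂ Set.Icc (-R) R := by
    rw [mem_reProdIm]
    simpa using ⟨⟨h1.le, h2⟩, ht⟩
  have hs1 : (σ + t * I : ℂ) ≠ 1 := by
    intro h
    have := congrArg Complex.re h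
    simp at this
    linarith
  have hsub : (σ - 1 : ℂ) + t * I = (σ + t * I) - 1 := by ring
  rw [hsub]
  have hA' := hA _ hmem
  have hB' := hB _ hmem
  have hZ := hne (σ + t * I) (mem_reProdIm.1 hmem).1.1
  generalize (σ + t * I : ℂ) = s at *
  have hs0 : s - 1 ≠ 0 := sub_ne_zero.2 hs1
  constructor
  · rw [riemannZeta_eq_inv_sub_mul hs1, norm_mul, norm_inv, inv_mul_eq_div]
    gcongr
    exact hA'.trans ((le_max_left _ _).trans (le_max_right _ _))
  · have : deriv riemannZeta s / riemannZeta s =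
        (s - 1)⁻¹ * (-1 + (s - 1) * (deriv riemannZeta₁ s / riemannZeta₁ s)) := by
      rw [deriv_riemannZeta_eq_neg_inv_sub_sq_mul_add hs1, riemannZeta_eq_inv_sub_mul hs1]
      field_simp
    rw [this, norm_mul, norm_inv, inv_mul_eq_div]
    gcongr
    exact hB'.trans ((le_max_right _ _).trans (le_max_right _ _))

lemma integral_inv_sq_add_sq_le {ε : ℝ} (hε : 0 < ε) (a b : ℝ) :
    (∫ t in a..b, (ε ^ 2 + t ^ 2)⁻¹) ≤ π / ε := by
  have h : ∀ t : ℝ, (ε ^ 2 + t ^ 2)⁻¹ = (ε ^ 2)⁻¹ * (1 + (t / ε) ^ 2)⁻¹ := by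
    intro t
    rw [← mul_inv]
    congr 1
    field_simp
  simp_rw [h]
  rw [intervalIntegral.integral_const_mul,
    intervalIntegral.integral_comp_div (fun t => (1 + t ^ 2)⁻¹) hε.ne', integral_inv_one_add_sq,
    smul_eq_mul]
  have h1 := arctan_lt_pi_div_two (b / ε)
  have h2 := neg_pi_div_two_lt_arctan (a / ε)
  have : (ε ^ 2)⁻¹ * (ε * (Real.arctan (b / ε) - Real.arctan (a / ε))) =
      (Real.arctan (b / ε) - Real.arctan (a / ε)) / ε := by field_simp
  rw [this]
  gcongr
  linarith

lemma integral_sq_norm_le_of_pole_bound {F : ℝ → ℂ} (hF : Continuous F) {ε M R : ℝ} (hε : 0 < ε)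
    (hR : 0 ≤ R) (h : ∀ t ∈ Set.Icc (-R) R, ‖F t‖ ≤ M / ‖(ε : ℂ) + t * I‖) :
    (∫ t in (-R)..R, ‖F t‖ ^ 2) ≤ M ^ 2 * (π / ε) := by
  have hpos : ∀ t : ℝ, 0 < ε ^ 2 + t ^ 2 := fun t => by positivity
  have hc : Continuous fun t : ℝ => M ^ 2 * (ε ^ 2 + t ^ 2)⁻¹ :=
    continuous_const.mul (Continuous.inv₀ (by fun_prop) fun t => (hpos t).ne')
  calc (∫ t in (-R)..R, ‖F t‖ ^ 2) ≤ ∫ t in (-R)..R, M ^ 2 * (ε ^ 2 + t ^ 2)⁻¹ := by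
        refine intervalIntegral.integral_mono_on (by linarith)
          (Continuous.intervalIntegrable (by fun_prop) _ _)
          (hc.intervalIntegrable _ _) fun t ht => ?_
        calc ‖F t‖ ^ 2 ≤ (M / ‖(ε : ℂ) + t * I‖) ^ 2 := by
              gcongr
              exact h t ht
          _ = M ^ 2 * (ε ^ 2 + t ^ 2)⁻¹ := by
              rw [div_pow, ← Complex.normSq_eq_norm_sq, Complex.normSq_add_mul_I, div_eq_mul_inv]
    _ ≤ _ := by
        rw [intervalIntegral.integral_const_mul]
        gcongr
        exact integral_inv_sq_add_sq_le hε _ _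

lemma vertical_ne_one {σ : ℝ} (hσ : 1 < σ) (t : ℝ) : (σ + t * I : ℂ) ≠ 1 := by
  intro h
  have := congrArg Complex.re h
  simp at this
  linarith

lemma analyticAt_riemannZeta_of_ne_one {s : ℂ} (hs : s ≠ 1) : AnalyticAt ℂ riemannZeta s :=
  differentiableOn_riemannZeta.analyticAt (isOpen_compl_singleton.mem_nhds hs)

lemma continuous_riemannZeta_vertical {σ : ℝ} (hσ : 1 < σ) :
    Continuous fun t : ℝ => riemannZeta (σ + t * I) :=
  continuous_iff_continuousAt.2 fun t =>
    (analyticAt_riemannZeta_of_ne_one (vertical_ne_one hσ t)).continuousAt.comp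
      (f := fun t : ℝ => (σ + t * I : ℂ)) (by fun_prop)

lemma continuous_deriv_riemannZeta_vertical {σ : ℝ} (hσ : 1 < σ) :
    Continuous fun t : ℝ => deriv riemannZeta (σ + t * I) :=
  continuous_iff_continuousAt.2 fun t =>
    (analyticAt_riemannZeta_of_ne_one (vertical_ne_one hσ t)).deriv.continuousAt.comp
      (f := fun t : ℝ => (σ + t * I : ℂ)) (by fun_prop)

/-- Since `ζ' = (ζ' / ζ) * ζ` and both factors have a simple pole at `1`, the majorant principle
gives short-interval bounds of order `1 / (σ - 1)`, uniformly in the height. -/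
lemma exists_integral_riemannZeta_bounds (δ : ℝ) (hδ : 0 < δ) : ∃ K > (0 : ℝ), ∀ σ T : ℝ,
    1 < σ → σ ≤ 2 →
    (∫ t in T..(T + δ), ‖riemannZeta (σ + t * I)‖ ^ 2) ≤ K / (σ - 1) ∧
    (∫ t in T..(T + δ), ‖deriv riemannZeta (σ + t * I)‖) ≤ K / (σ - 1) := by
  obtain ⟨M, hM, hb⟩ := exists_riemannZeta_pole_bound (2 * δ)
  refine ⟨2 * (M ^ 2 * π), by positivity, fun σ T h1 h2 => ?_⟩
  have hre : ∀ t : ℝ, 1 < (σ + t * I : ℂ).re := fun t => by simpa using h1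
  have hζc := continuous_riemannZeta_vertical h1
  have hdc := continuous_deriv_riemannZeta_vertical h1
  have hne : ∀ t : ℝ, riemannZeta (σ + t * I) ≠ 0 := fun t =>
    riemannZeta_ne_zero_of_one_le_re (hre t).le
  have hqc : Continuous fun t : ℝ => deriv riemannZeta (σ + t * I) / riemannZeta (σ + t * I) :=
    hdc.div hζc hne
  have hζ2 : Continuous fun t : ℝ => ‖riemannZeta (σ + t * I)‖ ^ 2 := hζc.norm.pow 2
  have hq2 : Continuous fun t : ℝ =>
      ‖deriv riemannZeta (σ + t * I) / riemannZeta (σ + t * I)‖ ^ 2 := hqc.norm.pow 2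
  have e1 : (∫ t in T..(T + δ), ‖riemannZeta (σ + t * I)‖ ^ 2) ≤ 2 * (M ^ 2 * π) / (σ - 1) := by
    have h := integral_sq_norm_LSeries_le (fun _ => 1) (fun _ => 1) (by simp) (by simp)
      (σ := σ) (LSeriesSummable_one_iff.2 (by simpa using h1)) T δ hδ
    have e : ∀ t : ℝ, LSeries (fun _ => 1) (σ + t * I) = riemannZeta (σ + t * I) := fun t =>
      LSeries_one_eq_riemannZeta (hre t)
    simp_rw [e] at h
    have h' := integral_sq_norm_le_of_pole_bound hζc (ε := σ - 1) (M := M) (R := 2 * δ)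
      (by linarith) (by linarith) (fun t ht => by
        push_cast
        exact (hb σ t h1 h2 ht).1)
    calc _ ≤ _ := h
      _ ≤ 2 * (M ^ 2 * (π / (σ - 1))) := by gcongr
      _ = _ := by ring
  have e2 : (∫ t in T..(T + δ), ‖deriv riemannZeta (σ + t * I) / riemannZeta (σ + t * I)‖ ^ 2) ≤
      2 * (M ^ 2 * π) / (σ - 1) := by
    have h := integral_sq_norm_LSeries_le (fun n => (ArithmeticFunction.vonMangoldt n : ℂ))
      (fun n => ArithmeticFunction.vonMangoldt n)
      (by simp) (fun n => ArithmeticFunction.vonMangoldt_nonneg)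
      (σ := σ) (ArithmeticFunction.LSeriesSummable_vonMangoldt (by simpa using h1)) T δ hδ
    have e : ∀ t : ℝ, ‖LSeries (fun n => (ArithmeticFunction.vonMangoldt n : ℂ)) (σ + t * I)‖ =
        ‖deriv riemannZeta (σ + t * I) / riemannZeta (σ + t * I)‖ := fun t => by
      rw [ArithmeticFunction.LSeries_vonMangoldt_eq_deriv_riemannZeta_div (hre t), neg_div,
        norm_neg]
    simp_rw [e] at h
    have h' := integral_sq_norm_le_of_pole_bound hqc (ε := σ - 1) (M := M) (R := 2 * δ)
      (by linarith) (by linarith) (fun t ht => by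
        push_cast
        exact (hb σ t h1 h2 ht).2)
    calc _ ≤ _ := h
      _ ≤ 2 * (M ^ 2 * (π / (σ - 1))) := by gcongr
      _ = _ := by ring
  refine ⟨e1, ?_⟩
  calc (∫ t in T..(T + δ), ‖deriv riemannZeta (σ + t * I)‖)
      ≤ ∫ t in T..(T + δ), (‖deriv riemannZeta (σ + t * I) / riemannZeta (σ + t * I)‖ ^ 2 +
          ‖riemannZeta (σ + t * I)‖ ^ 2) / 2 := by
        refine intervalIntegral.integral_mono_on (by linarith)
          (hdc.norm.intervalIntegrable _ _)
          (((hq2.add hζ2).div_const 2).intervalIntegrable _ _)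
          fun t _ => ?_
        have : ‖deriv riemannZeta (σ + t * I)‖ =
            ‖deriv riemannZeta (σ + t * I) / riemannZeta (σ + t * I)‖ *
              ‖riemannZeta (σ + t * I)‖ := by
          rw [← norm_mul, div_mul_cancel₀ _ (hne t)]
        rw [this]
        linarith [two_mul_le_add_sq ‖deriv riemannZeta (σ + t * I) / riemannZeta (σ + t * I)‖
          ‖riemannZeta (σ + t * I)‖]
    _ ≤ _ := by
        rw [intervalIntegral.integral_div, intervalIntegral.integral_add
          (hq2.intervalIntegrable _ _) (hζ2.intervalIntegrable _ _)]
        linarith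

lemma exists_integral_norm_riemannZeta_le_log (δ : ℝ) (hδ : 0 < δ) : ∃ K > (0 : ℝ), ∀ σ T : ℝ,
    1 < σ → σ ≤ 2 →
    (∫ t in T..(T + δ), ‖riemannZeta (σ + t * I)‖) ≤ δ + K + K * Real.log (1 / (σ - 1)) := by
  obtain ⟨K, hK, hb⟩ := exists_integral_riemannZeta_bounds δ hδ
  refine ⟨K, hK, fun σ T h1 h2 => ?_⟩
  have h2c : Continuous fun t : ℝ => ‖riemannZeta ((2 : ℝ) + t * I)‖ ^ 2 :=
    (continuous_riemannZeta_vertical (σ := 2) one_lt_two).norm.pow 2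
  have hjoint : ContinuousOn (fun p : ℝ × ℝ => ‖deriv riemannZeta (p.2 + p.1 * I)‖)
      (Set.univ ×ˢ Set.Icc σ 2) := by
    intro p hp
    refine ContinuousAt.continuousWithinAt ?_
    exact ((analyticAt_riemannZeta_of_ne_one
      (vertical_ne_one (h1.trans_le hp.2.1) p.1)).deriv.continuousAt.comp
      (f := fun p : ℝ × ℝ => (p.2 + p.1 * I : ℂ)) (by fun_prop)).norm
  have hint : Integrable (Function.uncurry fun t x : ℝ => ‖deriv riemannZeta (x + t * I)‖)
      ((volume.restrict (Set.uIoc T (T + δ))).prod (volume.restrict (Set.uIoc σ 2))) := by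
    rw [Measure.prod_restrict, ← Measure.volume_eq_prod, Set.uIoc_of_le (by linarith),
      Set.uIoc_of_le h2]
    have : IntegrableOn (fun p : ℝ × ℝ => ‖deriv riemannZeta (p.2 + p.1 * I)‖)
        (Set.Icc T (T + δ) ×ˢ Set.Icc σ 2) :=
      ContinuousOn.integrableOn_compact (isCompact_Icc.prod isCompact_Icc)
        (hjoint.mono (Set.prod_mono (Set.subset_univ _) le_rfl))
    exact this.mono_set (Set.prod_mono Set.Ioc_subset_Icc_self Set.Ioc_subset_Icc_self)
  have hint1 : IntervalIntegrable (fun t : ℝ => ∫ x in σ..2, ‖deriv riemannZeta (x + t * I)‖)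
      volume T (T + δ) := by
    rw [intervalIntegrable_iff]
    simp_rw [intervalIntegral.integral_of_le h2, ← Set.uIoc_of_le h2]
    exact hint.integral_prod_left
  have hint2 : IntervalIntegrable
      (fun x : ℝ => ∫ t in T..(T + δ), ‖deriv riemannZeta (x + t * I)‖) volume σ 2 := by
    rw [intervalIntegrable_iff]
    simp_rw [intervalIntegral.integral_of_le (by linarith : T ≤ T + δ),
      ← Set.uIoc_of_le (by linarith : T ≤ T + δ)]
    exact hint.integral_prod_right
  have hpt : ∀ t : ℝ, ‖riemannZeta (σ + t * I)‖ ≤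
      (1 + ‖riemannZeta ((2 : ℝ) + t * I)‖ ^ 2) + ∫ x in σ..2, ‖deriv riemannZeta (x + t * I)‖ := by
    intro t
    have hftc : (∫ x in σ..2, deriv riemannZeta (x + t * I)) =
        riemannZeta ((2 : ℝ) + t * I) - riemannZeta (σ + t * I) := by
      refine intervalIntegral.integral_eq_sub_of_hasDerivAt
        (f := fun x : ℝ => riemannZeta (x + t * I)) (fun x hx => ?_) ?_
      · rw [Set.uIcc_of_le h2] at hx
        have h := (analyticAt_riemannZeta_of_ne_one
          (vertical_ne_one (h1.trans_le hx.1) t)).differentiableAt.hasDerivAt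
        have h' := ((hasDerivAt_id (x : ℂ)).add_const (t * I : ℂ))
        simpa using (h.comp (x : ℂ) h').comp_ofReal
      · refine ContinuousOn.intervalIntegrable_of_Icc h2 fun x hx => ?_
        refine ContinuousAt.continuousWithinAt ?_
        exact (analyticAt_riemannZeta_of_ne_one
          (vertical_ne_one (h1.trans_le hx.1) t)).deriv.continuousAt.comp
          (f := fun x : ℝ => (x + t * I : ℂ)) (by fun_prop)
    have e : riemannZeta (σ + t * I) = riemannZeta ((2 : ℝ) + t * I) -
        ∫ x in σ..2, deriv riemannZeta (x + t * I) := by rw [hftc]; ring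
    rw [e]
    refine (norm_sub_le _ _).trans (add_le_add ?_ (intervalIntegral.norm_integral_le_integral_norm h2))
    nlinarith [sq_nonneg (‖riemannZeta ((2 : ℝ) + t * I)‖ - 1)]
  have hcst : IntervalIntegrable (fun t : ℝ => 1 + ‖riemannZeta ((2 : ℝ) + t * I)‖ ^ 2)
      volume T (T + δ) := (continuous_const.add h2c).intervalIntegrable _ _
  calc (∫ t in T..(T + δ), ‖riemannZeta (σ + t * I)‖)
      ≤ ∫ t in T..(T + δ), ((1 + ‖riemannZeta ((2 : ℝ) + t * I)‖ ^ 2) +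
          ∫ x in σ..2, ‖deriv riemannZeta (x + t * I)‖) :=
        intervalIntegral.integral_mono_on (by linarith)
          ((continuous_riemannZeta_vertical h1).norm.intervalIntegrable _ _)
          (hcst.add hint1) fun t _ => hpt t
    _ = (δ + ∫ t in T..(T + δ), ‖riemannZeta ((2 : ℝ) + t * I)‖ ^ 2) +
          ∫ x in σ..2, ∫ t in T..(T + δ), ‖deriv riemannZeta (x + t * I)‖ := by
        rw [intervalIntegral.integral_add hcst hint1, intervalIntegral.integral_add (by simp)
          (h2c.intervalIntegrable _ _),
          intervalIntegral_intervalIntegral_swap (by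
            rwa [Measure.prod_restrict, ← Measure.volume_eq_prod] at hint)]
        simp
    _ ≤ (δ + K / (2 - 1)) + ∫ x in σ..2, K * (x - 1)⁻¹ := by
        refine add_le_add (add_le_add le_rfl (hb 2 T one_lt_two le_rfl).1) ?_
        refine intervalIntegral.integral_mono_on h2 hint2 ?_ fun x hx => ?_
        · refine ContinuousOn.intervalIntegrable_of_Icc h2 ?_
          refine continuousOn_const.mul (ContinuousOn.inv₀ (by fun_prop) fun x hx => ?_)
          have := hx.1
          linarith
        · rw [← div_eq_mul_inv]
          exact (hb x T (h1.trans_le hx.1) hx.2).2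
    _ = _ := by
        rw [intervalIntegral.integral_const_mul,
          intervalIntegral.integral_comp_sub_right (fun x => x⁻¹) 1, integral_inv_of_pos
          (by linarith) (by norm_num)]
        norm_num

lemma norm_cpow_neg_sub_integral_le {s : ℂ} (hs : 1 ≤ s.re) (hs1 : s ≠ 1) {n : ℕ} (hn : 0 < n) :
    ‖(((n + 1 : ℕ) : ℂ) ^ (-s + 1) / (-s + 1) - (n : ℂ) ^ (-s + 1) / (-s + 1)) -
      (n : ℂ) ^ (-s)‖ ≤ ‖s‖ / (n : ℝ) ^ 2 := by
  have hn1 : (1 : ℝ) ≤ n := by exact_mod_cast hn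
  have hs0 : s ≠ 0 := by
    rintro rfl
    simp at hs
    linarith
  have h1 : ∀ u ∈ Set.Icc (n : ℝ) (n + 1),
      ‖(u : ℂ) ^ (-s) - ((n : ℝ) : ℂ) ^ (-s)‖ ≤ ‖s‖ / (n : ℝ) ^ 2 * (u - n) := by
    refine norm_image_sub_le_of_norm_deriv_le_segment' (f := fun u : ℝ => (u : ℂ) ^ (-s))
      (f' := fun u : ℝ => (-s) * (u : ℂ) ^ (-s - 1)) (fun u hu => ?_) fun u hu => ?_
    · have : u ≠ 0 := by linarith [hu.1]
      exact (hasDerivAt_ofReal_cpow_const this (neg_ne_zero.2 hs0)).hasDerivWithinAt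
    · have hu1 : 1 ≤ u := hn1.trans hu.1
      have hu0 : 0 < u := by linarith
      rw [norm_mul, norm_neg, Complex.norm_cpow_eq_rpow_re_of_pos hu0, div_eq_mul_inv]
      gcongr
      calc u ^ (-s - 1).re ≤ u ^ (-2 : ℝ) := by
            refine Real.rpow_le_rpow_of_exponent_le hu1 ?_
            simp
            linarith
        _ = (u ^ 2)⁻¹ := by rw [Real.rpow_neg hu0.le, Real.rpow_two]
        _ ≤ ((n : ℝ) ^ 2)⁻¹ := by
            gcongr
            exact hu.1
  have h2 := norm_image_sub_le_of_norm_deriv_le_segment'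
    (f := fun u : ℝ => (u : ℂ) ^ (-s + 1) / (-s + 1) - u * ((n : ℝ) : ℂ) ^ (-s))
    (f' := fun u : ℝ => (u : ℂ) ^ (-s) - 1 * ((n : ℝ) : ℂ) ^ (-s)) (a := n) (b := n + 1)
    (C := ‖s‖ / (n : ℝ) ^ 2) (fun u hu => ?_) (fun u hu => ?_) (n + 1) (by simp)
  · rw [add_sub_cancel_left, mul_one] at h2
    refine le_of_eq_of_le ?_ h2
    congr 1
    push_cast
    ring
  · have : u ≠ 0 := by linarith [hu.1]
    refine HasDerivAt.hasDerivWithinAt ((hasDerivAt_ofReal_cpow_const' this ?_).sub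
      (HasDerivAt.mul_const (hasDerivAt_id u).ofReal_comp _))
    exact fun h => hs1 (neg_injective h)
  · rw [one_mul]
    refine (h1 u ⟨hu.1, hu.2.le⟩).trans (mul_le_of_le_one_right (by positivity) ?_)
    linarith [hu.2]

lemma sum_inv_sq_shift_le {N : ℕ} (hN : 0 < N) (M : ℕ) :
    ∑ k ∈ Finset.range M, 1 / ((N + k : ℕ) : ℝ) ^ 2 ≤ 2 / N - 2 / ((N + M : ℕ) : ℝ) := by
  induction M with
  | zero => simp
  | succ M ih =>
    rw [Finset.sum_range_succ]
    have hx : (1 : ℝ) ≤ ((N + M : ℕ) : ℝ) := by exact_mod_cast (by omega : 1 ≤ N + M)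
    have e : ((N + (M + 1) : ℕ) : ℝ) = ((N + M : ℕ) : ℝ) + 1 := by push_cast; ring
    rw [e]
    generalize ((N + M : ℕ) : ℝ) = x at *
    have : 1 / x ^ 2 ≤ 2 / x - 2 / (x + 1) := by
      rw [div_sub_div _ _ (by positivity) (by positivity), div_le_div_iff₀ (by positivity)
        (by positivity)]
      nlinarith
    linarith

lemma norm_sum_cpow_neg_shift_le {σ t : ℝ} (hσ : 1 ≤ σ) (ht : 0 < t) {N : ℕ} (hN : 0 < N)
    (M : ℕ) :
    ‖∑ k ∈ Finset.range M, ((N + k : ℕ) : ℂ) ^ (-(σ + t * I : ℂ))‖ ≤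
      2 * ‖(σ + t * I : ℂ)‖ / N + 2 / t := by
  set s : ℂ := σ + t * I with hs
  have hre : s.re = σ := by simp [hs]
  have him : s.im = t := by simp [hs]
  have hs1 : s ≠ 1 := by
    intro h
    have := congrArg Complex.im h
    simp [him] at this
    linarith
  let P : ℕ → ℂ := fun n => (n : ℂ) ^ (-s + 1) / (-s + 1)
  have hP : ∀ n : ℕ, 0 < n → ‖P n‖ ≤ 1 / t := by
    intro n hn
    have hd : t ≤ ‖-s + 1‖ := by
      refine le_trans ?_ (Complex.abs_im_le_norm _)
      simp [him, le_abs_self]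
    simp only [P]
    rw [norm_div, Complex.norm_natCast_cpow_of_pos hn]
    gcongr
    refine Real.rpow_le_one_of_one_le_of_nonpos (by exact_mod_cast hn) ?_
    simp [hre]
    linarith
  have htel : ∑ k ∈ Finset.range M, (P (N + (k + 1)) - P (N + k)) = P (N + M) - P N :=
    Finset.sum_range_sub (fun k => P (N + k)) M
  have hdiff : ‖∑ k ∈ Finset.range M, ((P (N + (k + 1)) - P (N + k)) -
      ((N + k : ℕ) : ℂ) ^ (-s))‖ ≤ 2 * ‖s‖ / N := by
    calc _ ≤ ∑ k ∈ Finset.range M, ‖s‖ * (1 / ((N + k : ℕ) : ℝ) ^ 2) := by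
          refine (norm_sum_le _ _).trans (Finset.sum_le_sum fun k _ => ?_)
          rw [mul_one_div]
          exact norm_cpow_neg_sub_integral_le (n := N + k) (hσ.trans_eq hre.symm) hs1 (by omega)
      _ ≤ ‖s‖ * (2 / N) := by
          rw [← Finset.mul_sum]
          gcongr
          refine (sum_inv_sq_shift_le hN M).trans (sub_le_self _ (by positivity))
      _ = _ := by ring
  rw [Finset.sum_sub_distrib, htel] at hdiff
  have h1 := hP (N + M) (by omega)
  have h2 := hP N hN
  calc ‖∑ k ∈ Finset.range M, ((N + k : ℕ) : ℂ) ^ (-s)‖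
      = ‖(P (N + M) - P N) - ((P (N + M) - P N) -
          ∑ k ∈ Finset.range M, ((N + k : ℕ) : ℂ) ^ (-s))‖ := by rw [sub_sub_cancel]
    _ ≤ (‖P (N + M)‖ + ‖P N‖) + 2 * ‖s‖ / N :=
        (norm_sub_le _ _).trans (add_le_add (norm_sub_le _ _) hdiff)
    _ ≤ (1 / t + 1 / t) + 2 * ‖s‖ / N := by gcongr
    _ = _ := by ring

lemma norm_riemannZeta_sub_sum_le_of_one_lt {σ t : ℝ} (hσ : 1 < σ) (h2 : σ ≤ 2) (ht : 0 < t)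
    {N : ℕ} (hN : 0 < N) :
    ‖riemannZeta (σ + t * I) - ∑ n ∈ Finset.range N, (n : ℂ) ^ (-(σ + t * I : ℂ))‖ ≤
      2 * (2 + t) / N + 2 / t := by
  have hre : 1 < (σ + t * I : ℂ).re := by simpa using hσ
  have hsum : HasSum (fun n : ℕ => (n : ℂ) ^ (-(σ + t * I : ℂ))) (riemannZeta (σ + t * I)) := by
    rw [zeta_eq_tsum_one_div_nat_cpow hre]
    simp_rw [Complex.cpow_neg, ← one_div]
    exact (Complex.summable_one_div_nat_cpow.2 hre).hasSum
  have hlim := ((tendsto_add_atTop_iff_nat N).2 hsum.tendsto_sum_nat).sub_const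
    (∑ n ∈ Finset.range N, (n : ℂ) ^ (-(σ + t * I : ℂ)))
  refine le_of_tendsto' hlim.norm fun M => ?_
  rw [add_comm M N, Finset.sum_range_add, add_sub_cancel_left]
  refine (norm_sum_cpow_neg_shift_le hσ.le ht hN M).trans ?_
  gcongr
  refine (norm_add_le _ _).trans ?_
  rw [norm_mul, Complex.norm_I, Complex.norm_real, Complex.norm_real, mul_one,
    Real.norm_of_nonneg (by linarith), Real.norm_of_nonneg ht.le]
  linarith

/-- Approximation of `ζ` on the line of real part `1` by a partial sum of its Dirichlet series. -/
lemma norm_riemannZeta_one_sub_sum_le {t : ℝ} (ht : 0 < t) {N : ℕ} (hN : 0 < N) :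
    ‖riemannZeta (1 + t * I) - ∑ n ∈ Finset.range N, (n : ℂ) ^ (-(1 + t * I : ℂ))‖ ≤
      2 * (2 + t) / N + 2 / t := by
  have hne : ((1 : ℝ) + t * I : ℂ) ≠ 1 := by
    intro h
    have := congrArg Complex.im h
    simp at this
    linarith
  have hne0 : (-((1 : ℝ) + t * I) : ℂ) ≠ 0 := by
    intro h
    have := congrArg Complex.im h
    simp at this
    linarith
  have hc : ContinuousAt (fun σ : ℝ => ‖riemannZeta (σ + t * I) -
      ∑ n ∈ Finset.range N, (n : ℂ) ^ (-(σ + t * I : ℂ))‖) 1 := by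
    refine (ContinuousAt.sub ?_ (tendsto_finsetSum _ fun n _ => ?_)).norm
    · exact (differentiableAt_riemannZeta hne).continuousAt.comp
        (f := fun σ : ℝ => (σ + t * I : ℂ)) (by fun_prop)
    · exact ContinuousAt.const_cpow (f := fun σ : ℝ => (-(σ + t * I) : ℂ)) (by fun_prop)
        (Or.inr hne0)
  have h := hc.tendsto.mono_left (nhdsWithin_le_nhds (s := Set.Ioi 1))
  rw [Complex.ofReal_one] at h
  refine le_of_tendsto h ?_
  filter_upwards [Ioc_mem_nhdsGT (one_lt_two : (1 : ℝ) < 2)] with σ hσ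
  exact norm_riemannZeta_sub_sum_le_of_one_lt hσ.1 hσ.2 ht hN

lemma norm_sum_cpow_sub_sum_cpow_le {σ : ℝ} (hσ : 1 < σ) (t : ℝ) (N : ℕ) :
    ‖∑ n ∈ Finset.range N, (n : ℂ) ^ (-(1 + t * I : ℂ)) -
      ∑ n ∈ Finset.range N, (n : ℂ) ^ (-(σ + t * I : ℂ))‖ ≤
      (σ - 1) * Real.log N * (1 + Real.log N) := by
  have hterm : ∀ n ∈ Finset.range N,
      ‖(n : ℂ) ^ (-(1 + t * I : ℂ)) - (n : ℂ) ^ (-(σ + t * I : ℂ))‖ ≤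
        (σ - 1) * Real.log N * (n : ℝ)⁻¹ := by
    intro n hn
    rcases Nat.eq_zero_or_pos n with rfl | hpos
    · have h1 : (-(1 + t * I) : ℂ) ≠ 0 := by
        intro h
        have := congrArg Complex.re h
        simp at this
      have h2 : (-(σ + t * I) : ℂ) ≠ 0 := by
        intro h
        have := congrArg Complex.re h
        simp at this
        linarith
      simp only [Nat.cast_zero, Complex.zero_cpow h1, Complex.zero_cpow h2]
      simp
    · have hnR : (0 : ℝ) < n := by exact_mod_cast hpos
      have hn0 : (n : ℂ) ≠ 0 := by exact_mod_cast hpos.ne'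
      have e : (n : ℂ) ^ (-(σ + t * I : ℂ)) =
          (n : ℂ) ^ (-(1 + t * I : ℂ)) * (((n : ℝ) ^ (-(σ - 1)) : ℝ) : ℂ) := by
        rw [Complex.ofReal_cpow hnR.le, Complex.ofReal_natCast, ← Complex.cpow_add _ _ hn0]
        congr 1
        push_cast
        ring
      have hlog : Real.log n ≤ Real.log N :=
        Real.log_le_log hnR (by exact_mod_cast (Finset.mem_range.1 hn).le)
      have hle : (n : ℝ) ^ (-(σ - 1)) ≤ 1 :=
        Real.rpow_le_one_of_one_le_of_nonpos (by exact_mod_cast hpos) (by linarith)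
      have hge : 1 - (σ - 1) * Real.log n ≤ (n : ℝ) ^ (-(σ - 1)) := by
        rw [Real.rpow_def_of_pos hnR]
        linarith [Real.add_one_le_exp (Real.log n * -(σ - 1))]
      rw [e, ← mul_one_sub, norm_mul, Complex.norm_natCast_cpow_of_pos hpos, ← Complex.ofReal_one,
        ← Complex.ofReal_sub, Complex.norm_real, Real.norm_of_nonneg (by linarith)]
      have : (-(((1 : ℝ) : ℂ) + t * I)).re = -1 := by simp
      rw [this, Real.rpow_neg_one, mul_comm]
      gcongr
      nlinarith
  have hharm : ∑ n ∈ Finset.range N, (n : ℝ)⁻¹ ≤ 1 + Real.log N := by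
    have h := harmonic_le_one_add_log N
    have e : ((harmonic N : ℚ) : ℝ) = ∑ n ∈ Finset.range (N + 1), (n : ℝ)⁻¹ := by
      rw [Finset.sum_range_succ', harmonic]
      push_cast
      simp
    rw [e, Finset.sum_range_succ] at h
    have : (0 : ℝ) ≤ (N : ℝ)⁻¹ := by positivity
    linarith
  rw [← Finset.sum_sub_distrib]
  refine (norm_sum_le _ _).trans ((Finset.sum_le_sum hterm).trans ?_)
  rw [← Finset.mul_sum]
  have : 0 ≤ σ - 1 := by linarith
  gcongr

lemma norm_riemannZeta_one_le {T δ t : ℝ} (hδ : 0 < δ) (hT : Real.exp 1 ≤ T)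
    (ht : t ∈ Set.Icc T (T + δ)) :
    ‖riemannZeta (1 + t * I)‖ ≤
      ‖riemannZeta ((1 + 1 / Real.log T ^ 2 : ℝ) + t * I)‖ + (22 + 4 * δ) := by
  have hT2 : 2 ≤ T := by linarith [Real.add_one_le_exp (1 : ℝ)]
  have hL : 1 ≤ Real.log T := (Real.le_log_iff_exp_le (by linarith)).2 hT
  set L := Real.log T with hLdef
  have hN : T ≤ ⌈T⌉₊ := Nat.le_ceil T
  have hN' : (⌈T⌉₊ : ℝ) < T + 1 := Nat.ceil_lt_add_one (by linarith)
  have hNpos : 0 < ⌈T⌉₊ := Nat.ceil_pos.2 (by linarith)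
  generalize ⌈T⌉₊ = N at hN hN' hNpos
  have hNR : (0 : ℝ) < N := by exact_mod_cast hNpos
  have hlogN : Real.log N ≤ 2 * L := by
    have : Real.log N ≤ Real.log (T ^ 2) := Real.log_le_log hNR (by nlinarith)
    rwa [Real.log_pow] at this
  have hlogN0 : 0 ≤ Real.log N := Real.log_natCast_nonneg N
  have htpos : 0 < t := by linarith [ht.1]
  have hσ : 1 < 1 + 1 / L ^ 2 := by
    have : 0 < 1 / L ^ 2 := by positivity
    linarith
  have hσ2 : 1 + 1 / L ^ 2 ≤ 2 := by
    have : 1 / L ^ 2 ≤ 1 := by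
      rw [div_le_one (by positivity)]
      nlinarith
    linarith
  have hB : 2 * (2 + t) / N + 2 / t ≤ 8 + 2 * δ := by
    have h1 : 2 * (2 + t) / N ≤ 6 + 2 * δ := by
      rw [div_le_iff₀ hNR]
      nlinarith [ht.2]
    have h2 : 2 / t ≤ 2 := by
      rw [div_le_iff₀ htpos]
      linarith [ht.1]
    linarith
  have hD : (1 + 1 / L ^ 2 - 1) * Real.log N * (1 + Real.log N) ≤ 6 := by
    calc (1 + 1 / L ^ 2 - 1) * Real.log N * (1 + Real.log N)
        ≤ (1 + 1 / L ^ 2 - 1) * (2 * L) * (L + 2 * L) := by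
          have : 0 ≤ 1 + 1 / L ^ 2 - 1 := by linarith
          gcongr
      _ = 6 := by
          field_simp
          ring
  have h1 := norm_riemannZeta_one_sub_sum_le htpos hNpos
  have h2 := norm_riemannZeta_sub_sum_le_of_one_lt hσ hσ2 htpos hNpos
  have h3 := norm_sum_cpow_sub_sum_cpow_le hσ t N
  generalize (1 + 1 / L ^ 2 : ℝ) = σ at *
  generalize ∑ n ∈ Finset.range N, (n : ℂ) ^ (-(1 + t * I : ℂ)) = A at *
  generalize ∑ n ∈ Finset.range N, (n : ℂ) ^ (-(σ + t * I : ℂ)) = B at *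
  have e : riemannZeta (1 + t * I) = riemannZeta (σ + t * I) +
      ((riemannZeta (1 + t * I) - A) - (riemannZeta (σ + t * I) - B) + (A - B)) := by ring
  rw [e]
  refine (norm_add_le _ _).trans (add_le_add le_rfl ?_)
  refine (norm_add_le _ _).trans ?_
  linarith [norm_sub_le (riemannZeta (1 + t * I) - A) (riemannZeta (σ + t * I) - B)]

theorem stmt_10  (δ : ℝ) (hδ : 0 < δ) :
    ∃ C > (0 : ℝ), ∃ T₀ : ℝ, (3 : ℝ) ≤ T₀ ∧ ∀ T : ℝ, T₀ ≤ T →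
      (∫ t in T..(T + δ), ‖riemannZeta (1 + t * Complex.I)‖ ^ ((1 : ℝ))) ≤ C * Real.log (Real.log T) := by
  obtain ⟨K, hK, hb⟩ := exists_integral_norm_riemannZeta_le_log δ hδ
  refine ⟨2 * K + (δ + K + δ * (22 + 4 * δ)), by positivity,
    max 3 (Real.exp (Real.exp 1)), le_max_left _ _, fun T hT => ?_⟩
  have hT3 : 3 ≤ T := (le_max_left _ _).trans hT
  have hTe : Real.exp (Real.exp 1) ≤ T := (le_max_right _ _).trans hT
  have hL : Real.exp 1 ≤ Real.log T := (Real.le_log_iff_exp_le (by linarith)).2 hTe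
  have hLpos : 0 < Real.log T := (Real.exp_pos 1).trans_le hL
  have hLL : 1 ≤ Real.log (Real.log T) := (Real.le_log_iff_exp_le hLpos).2 hL
  have he1 : 1 ≤ Real.exp 1 := by linarith [Real.add_one_le_exp (1 : ℝ)]
  have hTe1 : Real.exp 1 ≤ T := le_trans (Real.exp_le_exp.2 he1) hTe
  have hσ : 1 < 1 + 1 / Real.log T ^ 2 := by
    have : 0 < 1 / Real.log T ^ 2 := by positivity
    linarith
  have hσ2 : 1 + 1 / Real.log T ^ 2 ≤ 2 := by
    have : 1 / Real.log T ^ 2 ≤ 1 := by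
      rw [div_le_one (by positivity)]
      nlinarith
    linarith
  have hbT := hb _ T hσ hσ2
  have hlog : Real.log (1 / (1 + 1 / Real.log T ^ 2 - 1)) = 2 * Real.log (Real.log T) := by
    rw [add_sub_cancel_left, one_div_one_div, Real.log_pow]
    norm_num
  rw [hlog] at hbT
  simp_rw [Real.rpow_one]
  have hcσ : Continuous fun t : ℝ =>
      ‖riemannZeta ((1 + 1 / Real.log T ^ 2 : ℝ) + t * I)‖ :=
    (continuous_riemannZeta_vertical hσ).norm
  have hc1 : ContinuousOn (fun t : ℝ => ‖riemannZeta (1 + t * I)‖) (Set.Icc T (T + δ)) := by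
    intro t ht
    have hne : (1 + t * I : ℂ) ≠ 1 := by
      intro h
      have := congrArg Complex.im h
      simp at this
      linarith [ht.1]
    exact ((differentiableAt_riemannZeta hne).continuousAt.comp
      (f := fun t : ℝ => (1 + t * I : ℂ)) (by fun_prop)).norm.continuousWithinAt
  calc (∫ t in T..(T + δ), ‖riemannZeta (1 + t * I)‖)
      ≤ ∫ t in T..(T + δ),
          (‖riemannZeta ((1 + 1 / Real.log T ^ 2 : ℝ) + t * I)‖ + (22 + 4 * δ)) :=
        intervalIntegral.integral_mono_on (by linarith)
          (hc1.intervalIntegrable_of_Icc (by linarith))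
          ((hcσ.add continuous_const).intervalIntegrable _ _)
          fun t ht => norm_riemannZeta_one_le hδ hTe1 ht
    _ = (∫ t in T..(T + δ), ‖riemannZeta ((1 + 1 / Real.log T ^ 2 : ℝ) + t * I)‖) +
          δ * (22 + 4 * δ) := by
        rw [intervalIntegral.integral_add (hcσ.intervalIntegrable _ _) (by simp),
          intervalIntegral.integral_const, add_sub_cancel_left, smul_eq_mul]
    _ ≤ (2 * K + (δ + K + δ * (22 + 4 * δ))) * Real.log (Real.log T) := by
        have : 0 ≤ δ + K + δ * (22 + 4 * δ) := by positivity
        nlinarith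
end
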